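/- Let (R, m) be a commutative Noetherian local ring, L, M, N finitely generated R-modules, and I an ideal such that I + ann_R M + ann_R N is m-primary. Fix nonnegative integers i and j. Then both Tor_j^R(L, Ext_R^i(N/I^n N, M)) and Ext_R^j(L, Ext_R^i(N/I^n N, M)) have finite length for all n ≥ 1, and there exist polynomials p and q with rational coefficients such that λ(Tor_j^R(L, Ext_R^i(N/I^n N, M))) = p(n) and λ(Ext_R^j(L, Ext_R^i(N/I^n N, M))) = q(n) for all sufficiently large n. -/

import Mathlib

set_option synthInstance.maxHeartbeats 1000000
set_option maxHeartbeats 1000000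

open CategoryTheory

universe u

/-- The length `λ(M)` of a module `M`, realized as the Krull dimension of the lattice of
submodules of `M`. -/
noncomputable def moduleLength (R M : Type*) [Ring R] [AddCommGroup M] [Module R M] :
    WithBot ℕ∞ :=
  Order.krullDim (Submodule R M)

/-- `Tor_i^R(A, B)`, as an `R`-module. -/
noncomputable abbrev torModule (R : Type u) [CommRing R] (i : ℕ) (A B : Type u)
    [AddCommGroup A] [Module R A] [AddCommGroup B] [Module R B] : Type u :=
  ↥(((Tor (ModuleCat.{u} R) i).obj (ModuleCat.of R A)).obj (ModuleCat.of R B))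

/-- `Ext_R^i(A, B)`, as an `R`-module. -/
noncomputable abbrev extModule (R : Type u) [CommRing R] (i : ℕ) (A B : Type u)
    [AddCommGroup A] [Module R A] [AddCommGroup B] [Module R B] : Type u :=
  ↥(((Ext R (ModuleCat.{u} R) i).obj (Opposite.op (ModuleCat.of R A))).obj (ModuleCat.of R B))

/-- A function `ℕ → ℕ` that eventually agrees with a polynomial with rational coefficients. -/
def EventuallyPolynomial (f : ℕ → ℕ) : Prop :=
  ∃ (p : Polynomial ℚ) (N : ℕ), ∀ n ≥ N, (f n : ℚ) = p.eval (n : ℚ)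

theorem Polynomial.exists_eval_add_one_sub_eval (p : Polynomial ℚ) :
    ∃ q : Polynomial ℚ, ∀ x : ℚ, q.eval (x + 1) - q.eval x = p.eval x := by
  induction p using Polynomial.induction_on' with
  | add p₁ p₂ h₁ h₂ =>
    obtain ⟨q₁, h₁⟩ := h₁
    obtain ⟨q₂, h₂⟩ := h₂
    refine ⟨q₁ + q₂, fun x => ?_⟩
    simp only [Polynomial.eval_add, ← h₁, ← h₂]
    ring
  | monomial n a =>
    refine ⟨Polynomial.C (a / (n + 1)) * Polynomial.bernoulli (n + 1), fun x => ?_⟩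
    have hn : (n : ℚ) + 1 ≠ 0 := by positivity
    rw [add_comm x 1]
    simp only [Polynomial.eval_mul, Polynomial.eval_C, Polynomial.bernoulli_eval_one_add,
      Polynomial.eval_monomial]
    push_cast
    field_simp
    simp
    ring

theorem EventuallyPolynomial.of_diff {f g h : ℕ → ℕ} (hg : EventuallyPolynomial g)
    (hh : EventuallyPolynomial h) (H : ∀ n, f (n + 1) + g n = f n + h n) :
    EventuallyPolynomial f := by
  obtain ⟨p, N₁, hp⟩ := hg
  obtain ⟨q, N₂, hq⟩ := hh
  obtain ⟨s, hs⟩ := (q - p).exists_eval_add_one_sub_eval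
  let N := max N₁ N₂
  refine ⟨s + Polynomial.C ((f N : ℚ) - s.eval (N : ℚ)), N, fun n hn => ?_⟩
  induction n, hn using Nat.le_induction with
  | base => simp
  | succ n hn ih =>
    have h₁ := hp n (le_trans (le_max_left _ _) hn)
    have h₂ := hq n (le_trans (le_max_right _ _) hn)
    have h₃ := hs n
    have h₄ : (f (n + 1) : ℚ) + g n = f n + h n := by exact_mod_cast H n
    simp only [Polynomial.eval_add, Polynomial.eval_C, Polynomial.eval_sub] at ih h₃ ⊢
    push_cast
    linarith

/-- A family of modules `A 0, A 1, …` with `r` operators `A (n + 1) → A n`. -/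
structure DescFam (R : Type u) [CommRing R] (r : ℕ) where
  /-- The components. -/
  obj : ℕ → ModuleCat.{u} R
  /-- The operators. -/
  x : Fin r → ∀ n, obj (n + 1) →ₗ[R] obj n

namespace DescFam

variable {R : Type u} [CommRing R] {r : ℕ}

/-- A family of submodules stable under the operators. -/
@[ext]
structure Sub (A : DescFam R r) where
  /-- The components. -/
  carrier : ∀ n, Submodule R (A.obj n)
  stable : ∀ k n, ∀ a ∈ carrier (n + 1), A.x k n a ∈ carrier n

instance (A : DescFam R r) : PartialOrder A.Sub :=
  PartialOrder.lift Sub.carrier fun _ _ => Sub.ext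

/-- The descending chain condition on stable families of submodules. -/
def IsArtin (A : DescFam R r) : Prop := WellFoundedLT A.Sub

theorem IsArtin.of_injOn {A B : DescFam R r} {s : ℕ} {C : DescFam R s}
    (hA : A.IsArtin) (hC : C.IsArtin)
    (α : B.Sub → A.Sub) (β : B.Sub → C.Sub) (hα : Monotone α) (hβ : Monotone β)
    (h : ∀ P Q : B.Sub, P ≤ Q → α Q ≤ α P → β Q ≤ β P → Q ≤ P) : B.IsArtin := by
  unfold IsArtin at *
  have : StrictMono fun P : B.Sub => (α P, β P) := by
    intro P Q hPQ
    refine lt_of_le_not_ge ⟨hα hPQ.le, hβ hPQ.le⟩ fun h' => ?_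
    exact hPQ.not_ge (h P Q hPQ.le h'.1 h'.2)
  exact this.wellFoundedLT

theorem IsArtin.of_exact {A B C : DescFam R r} (hA : A.IsArtin) (hC : C.IsArtin)
    (f : ∀ n, A.obj n →ₗ[R] B.obj n) (g : ∀ n, B.obj n →ₗ[R] C.obj n)
    (hf : ∀ k n a, f n (A.x k n a) = B.x k n (f (n + 1) a))
    (hg : ∀ k n b, g n (B.x k n b) = C.x k n (g (n + 1) b))
    (h : ∀ n b, g n b = 0 → ∃ a, f n a = b) : B.IsArtin := by
  refine IsArtin.of_injOn hA hC
    (fun P => ⟨fun n => (P.carrier n).comap (f n), fun k n a ha => ?_⟩)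
    (fun P => ⟨fun n => (P.carrier n).map (g n), fun k n a ha => ?_⟩) ?_ ?_ ?_
  · simp only [Submodule.mem_comap] at ha ⊢
    rw [hf]
    exact P.stable _ _ _ ha
  · obtain ⟨b, hb, rfl⟩ := ha
    exact ⟨_, P.stable k _ _ hb, hg _ _ _⟩
  · exact fun P Q hPQ n => Submodule.comap_mono (hPQ n)
  · exact fun P Q hPQ n => Submodule.map_mono (hPQ n)
  · intro P Q hPQ h₁ h₂ n b hb
    obtain ⟨b', hb', hbb⟩ := h₂ n ⟨b, hb, rfl⟩
    obtain ⟨a, ha⟩ := h n (b - b') (by simp [hbb])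
    have : a ∈ (P.carrier n).comap (f n) := h₁ n (by
      simp only [Submodule.mem_comap, ha]
      exact sub_mem hb (hPQ n hb'))
    rw [Submodule.mem_comap, ha] at this
    simpa using (add_mem this hb')

/-- The family of zero modules. -/
def zero (R : Type u) [CommRing R] (r : ℕ) : DescFam R r where
  obj _ := ModuleCat.of R PUnit
  x _ _ := 0

theorem isArtin_zero : (zero R r).IsArtin := by
  have : Subsingleton (zero R r).Sub :=
    ⟨fun P Q => by ext n a; rw [show a = 0 from rfl]; simp⟩
  exact (inferInstance : WellFoundedLT (zero R r).Sub)

theorem IsArtin.of_injective {A B : DescFam R r} (hB : B.IsArtin)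
    (f : ∀ n, A.obj n →ₗ[R] B.obj n)
    (hf : ∀ k n a, f n (A.x k n a) = B.x k n (f (n + 1) a))
    (h : ∀ n, Function.Injective (f n)) : A.IsArtin :=
  isArtin_zero.of_exact hB (fun _ => 0) f (by simp) hf
    fun n b hb => ⟨0, (h n (by simpa using hb)).symm⟩

theorem IsArtin.of_surjective {A B : DescFam R r} (hA : A.IsArtin)
    (f : ∀ n, A.obj n →ₗ[R] B.obj n)
    (hf : ∀ k n a, f n (A.x k n a) = B.x k n (f (n + 1) a))
    (h : ∀ n, Function.Surjective (f n)) : B.IsArtin :=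
  hA.of_exact isArtin_zero f (fun _ => 0) hf (by simp) fun n b _ => h n b

/-- The operators commute with each other. -/
def Comm (A : DescFam R r) : Prop :=
  ∀ k l n a, A.x k n (A.x l (n + 1) a) = A.x l n (A.x k (n + 1) a)

/-- The kernel of the first operator, as a family over the remaining ones. -/
def kerHead (A : DescFam R (r + 1)) (hA : A.Comm) : DescFam R r where
  obj n := ModuleCat.of R (LinearMap.ker (A.x 0 n))
  x k n := (A.x k.succ (n + 1)).restrict fun a ha => by
    rw [LinearMap.mem_ker] at ha ⊢
    rw [hA, ha, map_zero]

/-- The cokernel of the first operator, as a family over the remaining ones. -/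
def cokerHead (A : DescFam R (r + 1)) (hA : A.Comm) : DescFam R r where
  obj n := ModuleCat.of R (A.obj n ⧸ LinearMap.range (A.x 0 n))
  x k n := Submodule.mapQ _ _ (A.x k.succ n) (by
    rintro _ ⟨a, rfl⟩
    exact ⟨_, hA _ _ _ _⟩)

theorem kerHead_comm {A : DescFam R (r + 1)} (hA : A.Comm) : (A.kerHead hA).Comm :=
  fun k l n a => Subtype.ext (hA k.succ l.succ (n + 1) a.1)

theorem cokerHead_comm {A : DescFam R (r + 1)} (hA : A.Comm) : (A.cokerHead hA).Comm := by
  intro k l n a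
  obtain ⟨a, rfl⟩ := Submodule.mkQ_surjective _ a
  exact congrArg (Submodule.mkQ (LinearMap.range (A.x 0 n))) (hA k.succ l.succ n a)

theorem IsArtin.kerHead {A : DescFam R (r + 1)} (hA : A.Comm) (h : A.IsArtin) :
    (A.kerHead hA).IsArtin := by
  refine IsArtin.of_injOn (A := zero R r) isArtin_zero h (fun _ => ⟨fun _ => ⊥, by simp⟩)
    (fun P => ⟨fun n => match n with
      | 0 => ⊤
      | n + 1 => (P.carrier n).map (LinearMap.ker (A.x 0 n)).subtype, ?_⟩)
    (fun _ _ _ => le_rfl) ?_ ?_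
  · intro k n a ha
    obtain ⟨a, ha, rfl⟩ := ha
    cases n with
    | zero => trivial
    | succ n =>
      cases k using Fin.cases with
      | zero =>
        have : A.x 0 (n + 1) a.1 = 0 := a.2
        simp only [Submodule.subtype_apply, this]
        exact zero_mem _
      | succ k => exact ⟨_, P.stable k n a ha, rfl⟩
  · intro P Q hPQ n
    cases n with
    | zero => exact le_rfl
    | succ n => exact Submodule.map_mono (hPQ n)
  · intro P Q hPQ _ h n a ha
    obtain ⟨b, hb, hab⟩ := h (n + 1) ⟨a, ha, rfl⟩
    rwa [← Subtype.ext hab]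

theorem IsArtin.cokerHead {A : DescFam R (r + 1)} (hA : A.Comm) (h : A.IsArtin) :
    (A.cokerHead hA).IsArtin := by
  refine IsArtin.of_injOn (A := zero R r) isArtin_zero h (fun _ => ⟨fun _ => ⊥, by simp⟩)
    (fun P => ⟨fun n => (P.carrier n).comap (LinearMap.range (A.x 0 n)).mkQ, ?_⟩)
    (fun _ _ _ => le_rfl) ?_ ?_
  · intro k n a ha
    cases k using Fin.cases with
    | zero =>
      have : (LinearMap.range (A.x 0 n)).mkQ (A.x 0 n a) = 0 := by simp
      exact (congrArg (· ∈ P.carrier n) this).mpr (zero_mem _)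
    | succ k => exact P.stable k n _ ha
  · exact fun P Q hPQ n => Submodule.comap_mono (hPQ n)
  · intro P Q hPQ _ h n a ha
    obtain ⟨a, rfl⟩ := Submodule.mkQ_surjective _ a
    exact h n ha

theorem toNat_length_ker_add {A B : Type*} [AddCommGroup A] [Module R A] [AddCommGroup B]
    [Module R B] (hA : IsFiniteLength R A) (hB : IsFiniteLength R B) (f : A →ₗ[R] B) :
    (Module.length R A).toNat + (Module.length R (B ⧸ LinearMap.range f)).toNat =
      (Module.length R B).toNat + (Module.length R (LinearMap.ker f)).toNat := by
  have h₁ := Module.length_eq_add_of_exact (LinearMap.ker f).subtype f.rangeRestrict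
    (Submodule.subtype_injective _) f.surjective_rangeRestrict
    (by rw [LinearMap.exact_iff]; simp)
  have h₂ := Module.length_eq_add_of_exact (LinearMap.range f).subtype (LinearMap.range f).mkQ
    (Submodule.subtype_injective _) (Submodule.mkQ_surjective _)
    (by rw [LinearMap.exact_iff]; simp)
  have hk := Module.length_ne_top_iff.mpr (hA.of_injective (LinearMap.ker f).injective_subtype)
  have hr := Module.length_ne_top_iff.mpr (hB.of_injective (LinearMap.range f).injective_subtype)
  have hc := Module.length_ne_top_iff.mpr (hB.of_surjective (LinearMap.range f).mkQ_surjective)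
  rw [h₁, h₂, ENat.toNat_add hk hr, ENat.toNat_add hr hc]
  ring

theorem eventuallyPolynomial_length (A : DescFam R r) (hc : A.Comm) (hA : A.IsArtin)
    (hfl : ∀ n, IsFiniteLength R (A.obj n)) :
    EventuallyPolynomial fun n => (Module.length R (A.obj n)).toNat := by
  induction r with
  | zero =>
    let P : ℕ →o A.Subᵒᵈ :=
      ⟨fun s => OrderDual.toDual ⟨fun n => if s ≤ n then ⊤ else ⊥, fun k => k.elim0⟩, by
        intro s s' hs n
        change (if s' ≤ n then ⊤ else ⊥) ≤ (if s ≤ n then ⊤ else ⊥)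
        split_ifs <;> first | exact le_rfl | exact bot_le | omega⟩
    have : WellFoundedGT A.Subᵒᵈ := by
      unfold IsArtin at hA
      infer_instance
    obtain ⟨s, hs⟩ := WellFoundedGT.monotone_chain_condition P
    refine ⟨0, s, fun n hn => ?_⟩
    have h' : (if s ≤ n then (⊤ : Submodule R (A.obj n)) else ⊥) = if n + 1 ≤ n then ⊤ else ⊥ :=
      congrArg (fun Q : A.Subᵒᵈ => (OrderDual.ofDual Q).carrier n) (hs (n + 1) (by omega))
    rw [if_pos hn, if_neg (by omega)] at h'
    have : Subsingleton (A.obj n) := by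
      rw [← Submodule.subsingleton_iff R]
      exact (subsingleton_iff_bot_eq_top).mp h'.symm
    simp
  | succ r ih =>
    refine EventuallyPolynomial.of_diff
      (ih (A.cokerHead hc) (cokerHead_comm hc) (hA.cokerHead hc)
        fun n => (hfl n).of_surjective (Submodule.mkQ_surjective _))
      (ih (A.kerHead hc) (kerHead_comm hc) (hA.kerHead hc)
        fun n => (hfl (n + 1)).of_injective (Submodule.injective_subtype _)) fun n => ?_
    exact toNat_length_ker_add (hfl (n + 1)) (hfl n) (A.x 0 n)

end DescFam

/-- A family of modules with `r` operators lowering the degree by one and an operator `t` raising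
the degree by one, all commuting with each other. -/
structure ReesFam (R : Type u) [CommRing R] (r : ℕ) where
  /-- The components. -/
  obj : ℕ → ModuleCat.{u} R
  /-- The operators lowering the degree. -/
  x : Fin r → ∀ n, obj (n + 1) ⟶ obj n
  /-- The operator raising the degree. -/
  t : ∀ n, obj n ⟶ obj (n + 1)
  x_comm : ∀ k l n, x l (n + 1) ≫ x k n = x k (n + 1) ≫ x l n
  t_comm : ∀ k n, x k n ≫ t n = t (n + 1) ≫ x k (n + 1)

namespace ReesFam

variable {R : Type u} [CommRing R] {r : ℕ}

theorem x_x_apply (X : ReesFam R r) (k l n) (a : X.obj (n + 1 + 1)) :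
    X.x k n (X.x l (n + 1) a) = X.x l n (X.x k (n + 1) a) := by
  simpa using congr($(X.x_comm k l n) a)

theorem t_x_apply (X : ReesFam R r) (k n) (a : X.obj (n + 1)) :
    X.t n (X.x k n a) = X.x k (n + 1) (X.t (n + 1) a) := by
  simpa using congr($(X.t_comm k n) a)

/-- The kernel of `t`. -/
def ker (X : ReesFam R r) : DescFam R r where
  obj n := ModuleCat.of R (LinearMap.ker (X.t n).hom)
  x k n := (X.x k n).hom.restrict fun a ha => by
    rw [LinearMap.mem_ker] at ha ⊢
    rw [t_x_apply, ha, map_zero]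

/-- The inclusion of the kernel of `t`. -/
def kerι (X : ReesFam R r) (n : ℕ) : X.ker.obj n →ₗ[R] X.obj n :=
  (LinearMap.ker (X.t n).hom).subtype

theorem kerι_injective (X : ReesFam R r) (n : ℕ) : Function.Injective (X.kerι n) :=
  Submodule.subtype_injective _

theorem t_kerι (X : ReesFam R r) (n : ℕ) (a : X.ker.obj n) : X.t n (X.kerι n a) = 0 := a.2

theorem exists_kerι (X : ReesFam R r) {n : ℕ} {a : X.obj n} (h : X.t n a = 0) :
    ∃ b, X.kerι n b = a := ⟨⟨a, h⟩, rfl⟩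

theorem kerι_x (X : ReesFam R r) (k n) (a : X.ker.obj (n + 1)) :
    X.kerι n (X.ker.x k n a) = X.x k n (X.kerι (n + 1) a) := rfl

/-- The cokernel of `t`. -/
def coker (X : ReesFam R r) : DescFam R r where
  obj n := ModuleCat.of R (X.obj (n + 1) ⧸ LinearMap.range (X.t n).hom)
  x k n := Submodule.mapQ _ _ (X.x k (n + 1)).hom (by
    rintro _ ⟨a, rfl⟩
    exact ⟨_, X.t_x_apply _ _ _⟩)

/-- The projection to the cokernel of `t`. -/
def cokerπ (X : ReesFam R r) (n : ℕ) : X.obj (n + 1) →ₗ[R] X.coker.obj n :=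
  (LinearMap.range (X.t n).hom).mkQ

theorem cokerπ_surjective (X : ReesFam R r) (n : ℕ) : Function.Surjective (X.cokerπ n) :=
  Submodule.mkQ_surjective _

theorem cokerπ_eq_zero_iff (X : ReesFam R r) {n : ℕ} {a : X.obj (n + 1)} :
    X.cokerπ n a = 0 ↔ ∃ b, X.t n b = a :=
  Submodule.Quotient.mk_eq_zero _

theorem cokerπ_t (X : ReesFam R r) {n : ℕ} (a : X.obj n) : X.cokerπ n (X.t n a) = 0 :=
  X.cokerπ_eq_zero_iff.2 ⟨a, rfl⟩

theorem cokerπ_x (X : ReesFam R r) (k n) (a : X.obj (n + 1 + 1)) :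
    X.cokerπ n (X.x k (n + 1) a) = X.coker.x k n (X.cokerπ (n + 1) a) := rfl

/-- The components have finite length, and the kernel and cokernel of `t` satisfy the descending
chain condition on families of submodules. -/
structure IsGood (X : ReesFam R r) : Prop where
  isFiniteLength : ∀ n, IsFiniteLength R (X.obj n)
  ker : X.ker.IsArtin
  coker : X.coker.IsArtin

theorem IsGood.eventuallyPolynomial_length {X : ReesFam R r} (hX : X.IsGood) :
    EventuallyPolynomial fun n => (Module.length R (X.obj n)).toNat := by
  refine EventuallyPolynomial.of_diff
    (X.ker.eventuallyPolynomial_length ?_ hX.ker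
      fun n => (hX.isFiniteLength n).of_injective (X.kerι_injective n))
    (X.coker.eventuallyPolynomial_length ?_ hX.coker
      fun n => (hX.isFiniteLength (n + 1)).of_surjective (X.cokerπ_surjective n)) fun n => ?_
  · exact fun k l n a => Subtype.ext (X.x_x_apply k l n a.1)
  · intro k l n a
    obtain ⟨a, rfl⟩ := X.cokerπ_surjective _ a
    exact congrArg (X.cokerπ n) (X.x_x_apply k l (n + 1) a)
  · exact (DescFam.toNat_length_ker_add (hX.isFiniteLength n) (hX.isFiniteLength (n + 1))
      (X.t n).hom).symm

/-- A morphism of families. -/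
structure Hom (X Y : ReesFam R r) where
  /-- The components. -/
  app : ∀ n, X.obj n →ₗ[R] Y.obj n
  app_x : ∀ k n a, app n (X.x k n a) = Y.x k n (app (n + 1) a)
  app_t : ∀ n a, app (n + 1) (X.t n a) = Y.t n (app n a)

/-- The map induced on kernels of `t`. -/
def Hom.ker {X Y : ReesFam R r} (f : X.Hom Y) (n : ℕ) : X.ker.obj n →ₗ[R] Y.ker.obj n :=
  (f.app n).restrict fun a ha => by
    rw [LinearMap.mem_ker] at ha ⊢
    rw [← f.app_t, ha, map_zero]

theorem Hom.kerι_ker {X Y : ReesFam R r} (f : X.Hom Y) (n : ℕ) (a : X.ker.obj n) :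
    Y.kerι n (f.ker n a) = f.app n (X.kerι n a) := rfl

theorem Hom.ker_x {X Y : ReesFam R r} (f : X.Hom Y) (k n) (a : X.ker.obj (n + 1)) :
    f.ker n (X.ker.x k n a) = Y.ker.x k n (f.ker (n + 1) a) :=
  Subtype.ext (f.app_x k n a.1)

/-- The map induced on cokernels of `t`. -/
def Hom.coker {X Y : ReesFam R r} (f : X.Hom Y) (n : ℕ) : X.coker.obj n →ₗ[R] Y.coker.obj n :=
  Submodule.mapQ _ _ (f.app (n + 1)) (by
    rintro _ ⟨a, rfl⟩
    exact ⟨_, (f.app_t _ _).symm⟩)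

theorem Hom.coker_cokerπ {X Y : ReesFam R r} (f : X.Hom Y) (n : ℕ) (a : X.obj (n + 1)) :
    f.coker n (X.cokerπ n a) = Y.cokerπ n (f.app (n + 1) a) := rfl

theorem Hom.coker_x {X Y : ReesFam R r} (f : X.Hom Y) (k n) (a : X.coker.obj (n + 1)) :
    f.coker n (X.coker.x k n a) = Y.coker.x k n (f.coker (n + 1) a) := by
  obtain ⟨a, rfl⟩ := X.cokerπ_surjective _ a
  exact congrArg (Y.cokerπ n) (f.app_x k (n + 1) a)

variable {A B C : ReesFam R r} (f : A.Hom B) (g : B.Hom C)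

theorem IsGood.of_kernel (hB : B.IsGood) (hC : C.IsGood)
    (hf : ∀ n, Function.Injective (f.app n))
    (hfg : ∀ n, Function.Exact (f.app n) (g.app n)) : A.IsGood where
  isFiniteLength n := (hB.isFiniteLength n).of_injective (hf n)
  ker := hB.ker.of_injective f.ker f.ker_x fun n a b hab =>
    A.kerι_injective n (hf n (congrArg (B.kerι n) hab))
  coker := by
    refine DescFam.IsArtin.of_injOn hC.ker hB.coker
      (fun P => ⟨fun n => ((((P.carrier n).comap (A.cokerπ n)).map
        (f.app (n + 1))).comap (B.t n).hom).map (g.app n) |>.comap (C.kerι n), ?_⟩)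
      (fun P => ⟨fun n => (P.carrier n).map (f.coker n), ?_⟩) ?_ ?_ ?_
    · rintro k n c ⟨b, ⟨a, ha, hab⟩, hb⟩
      refine ⟨B.x k n b, ⟨A.x k (n + 1) a, ?_, ?_⟩, ?_⟩
      · exact P.stable k n _ ha
      · rw [f.app_x, hab]
        exact (B.t_x_apply _ _ _).symm
      · rw [g.app_x, hb, kerι_x]
    · rintro k n _ ⟨a, ha, rfl⟩
      exact ⟨_, P.stable k n _ ha, f.coker_x _ _ _⟩
    · exact fun P Q h n => Submodule.comap_mono (Submodule.map_mono (Submodule.comap_mono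
        (Submodule.map_mono (Submodule.comap_mono (h n)))))
    · exact fun P Q h n => Submodule.map_mono (h n)
    · intro P Q hPQ h₁ h₂ n a ha
      obtain ⟨a, rfl⟩ := A.cokerπ_surjective n a
      obtain ⟨a', ha', haa⟩ := h₂ n ⟨_, ha, rfl⟩
      obtain ⟨a', rfl⟩ := A.cokerπ_surjective n a'
      rw [f.coker_cokerπ, f.coker_cokerπ, eq_comm, ← sub_eq_zero, ← map_sub, ← map_sub,
        cokerπ_eq_zero_iff] at haa
      obtain ⟨b, hb⟩ := haa
      have hQ : A.cokerπ n (a - a') ∈ Q.carrier n := by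
        rw [map_sub]
        exact sub_mem ha (hPQ n ha')
      obtain ⟨c, hc⟩ := C.exists_kerι (a := g.app n b) (by
        rw [← g.app_t, hb]
        exact (hfg (n + 1)).apply_apply_eq_zero _)
      obtain ⟨b', ⟨a'', ha'', hab⟩, hbb⟩ := h₁ n
        (show c ∈ _ from ⟨b, ⟨a - a', hQ, hb.symm⟩, hc.symm⟩)
      obtain ⟨d, hd⟩ := (hfg n (b - b')).1 (by rw [map_sub, hbb, hc, sub_self])
      have key : a - a' - a'' = A.t n d := hf _ (by
        rw [f.app_t, hd, map_sub, hab, ← hb, map_sub])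
      have : A.cokerπ n a = A.cokerπ n a' + A.cokerπ n a'' := by
        rw [← map_add, ← sub_eq_zero, ← map_sub, ← sub_sub, key, cokerπ_t]
      rw [this]
      exact add_mem ha' ha''

theorem IsGood.of_cokernel (hA : A.IsGood) (hB : B.IsGood)
    (hg : ∀ n, Function.Surjective (g.app n))
    (hfg : ∀ n, Function.Exact (f.app n) (g.app n)) : C.IsGood where
  isFiniteLength n := (hB.isFiniteLength n).of_surjective (hg n)
  coker := hB.coker.of_surjective g.coker g.coker_x fun n c => by
    obtain ⟨c, rfl⟩ := C.cokerπ_surjective n c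
    obtain ⟨b, rfl⟩ := hg _ c
    exact ⟨B.cokerπ n b, rfl⟩
  ker := by
    refine DescFam.IsArtin.of_injOn hA.coker hB.ker
      (fun P => ⟨fun n => (((((P.carrier n).map (C.kerι n)).comap (g.app n)).map
        (B.t n).hom).comap (f.app (n + 1))).map (A.cokerπ n), ?_⟩)
      (fun P => ⟨fun n => (P.carrier n).comap (g.ker n), ?_⟩) ?_ ?_ ?_
    · rintro k n _ ⟨a, ⟨b, ⟨c, hc, hcb⟩, hb⟩, rfl⟩
      refine ⟨A.x k (n + 1) a, ⟨B.x k n b, ⟨_, P.stable k n _ hc, ?_⟩, ?_⟩, A.cokerπ_x _ _ _⟩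
      · rw [kerι_x, hcb, g.app_x]
      · rw [f.app_x, ← hb]
        exact B.t_x_apply _ _ _
    · intro k n b hb
      rw [Submodule.mem_comap, g.ker_x]
      exact P.stable k n _ hb
    · exact fun P Q h n => Submodule.map_mono (Submodule.comap_mono (Submodule.map_mono
        (Submodule.comap_mono (Submodule.map_mono (h n)))))
    · exact fun P Q h n => Submodule.comap_mono (h n)
    · intro P Q hPQ h₁ h₂ n c hc
      obtain ⟨b, hb⟩ := hg n (C.kerι n c)
      obtain ⟨a, ha⟩ := (hfg (n + 1) (B.t n b)).1 (by rw [g.app_t, hb, t_kerι])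
      obtain ⟨a', ⟨b', ⟨c', hc', hcb⟩, hab⟩, haa⟩ := h₁ n
        ⟨a, ⟨b, ⟨c, hc, hb.symm⟩, ha.symm⟩, rfl⟩
      rw [← sub_eq_zero, ← map_sub, cokerπ_eq_zero_iff] at haa
      obtain ⟨d, hd⟩ := haa
      have hab : B.t n b' = f.app (n + 1) a' := hab
      obtain ⟨e, he⟩ := B.exists_kerι (a := b' - b - f.app n d) (by
        rw [map_sub, map_sub, hab, ← ha, ← f.app_t, hd, map_sub, sub_self])
      have hge : g.ker n e = c' - c := C.kerι_injective n (by
        rw [g.kerι_ker, he, map_sub, map_sub, map_sub, (hfg n).apply_apply_eq_zero, hb, hcb,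
          sub_zero])
      have hP : g.ker n e ∈ P.carrier n := h₂ n (show e ∈ _ by
        rw [Submodule.mem_comap, hge]
        exact sub_mem (hPQ n hc') hc)
      rw [hge] at hP
      simpa using sub_mem hc' hP

theorem IsGood.of_extension (hA : A.IsGood) (hC : C.IsGood)
    (hf : ∀ n, Function.Injective (f.app n)) (hg : ∀ n, Function.Surjective (g.app n))
    (hfg : ∀ n, Function.Exact (f.app n) (g.app n)) : B.IsGood where
  isFiniteLength n := by
    have h₁ := isFiniteLength_iff_isNoetherian_isArtinian.mp (hA.isFiniteLength n)
    have h₂ := isFiniteLength_iff_isNoetherian_isArtinian.mp (hC.isFiniteLength n)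
    have := h₁.1
    have := h₁.2
    have := h₂.1
    have := h₂.2
    exact isFiniteLength_iff_isNoetherian_isArtinian.mpr
      ⟨isNoetherian_of_range_eq_ker _ _ (hfg n).linearMap_ker_eq.symm,
        isArtinian_of_range_eq_ker _ _ (hfg n).linearMap_ker_eq.symm⟩
  ker := hA.ker.of_exact hC.ker f.ker g.ker f.ker_x g.ker_x fun n b hb => by
    obtain ⟨a, ha⟩ := (hfg n (B.kerι n b)).1 (by rw [← g.kerι_ker, hb, map_zero])
    obtain ⟨a, rfl⟩ := A.exists_kerι (a := a) (hf _ (by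
      rw [f.app_t, ha, t_kerι, map_zero]))
    exact ⟨a, B.kerι_injective n ha⟩
  coker := hA.coker.of_exact hC.coker f.coker g.coker f.coker_x g.coker_x fun n b hb => by
    obtain ⟨b, rfl⟩ := B.cokerπ_surjective n b
    rw [g.coker_cokerπ, cokerπ_eq_zero_iff] at hb
    obtain ⟨c, hc⟩ := hb
    obtain ⟨b', rfl⟩ := hg n c
    obtain ⟨a, ha⟩ := (hfg (n + 1) (b - B.t n b')).1 (by rw [map_sub, g.app_t, hc, sub_self])
    refine ⟨A.cokerπ n a, ?_⟩
    rw [f.coker_cokerπ, ha, map_sub, cokerπ_t, sub_zero]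

/-- The image of a family under a functor. -/
@[simps]
def map (X : ReesFam R r) (Φ : ModuleCat.{u} R ⥤ ModuleCat.{u} R) : ReesFam R r where
  obj n := Φ.obj (X.obj n)
  x k n := Φ.map (X.x k n)
  t n := Φ.map (X.t n)
  x_comm k l n := by simp only [← Φ.map_comp, X.x_comm]
  t_comm k n := by simp only [← Φ.map_comp, X.t_comm]

/-- The morphism of families induced by a natural transformation. -/
def homMap (X : ReesFam R r) {Φ Ψ : ModuleCat.{u} R ⥤ ModuleCat.{u} R} (α : Φ ⟶ Ψ) :
    (X.map Φ).Hom (X.map Ψ) where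
  app n := (α.app (X.obj n)).hom
  app_x k n a := congr($(α.naturality (X.x k n)) a)
  app_t n a := congr($(α.naturality (X.t n)) a)

end ReesFam

/-- A functor preserving good families. -/
def PreservesGood {R : Type u} [CommRing R] (Φ : ModuleCat.{u} R ⥤ ModuleCat.{u} R) : Prop :=
  ∀ ⦃r : ℕ⦄ (X : ReesFam R r), X.IsGood → (X.map Φ).IsGood

namespace PreservesGood

variable {R : Type u} [CommRing R] {Φ Ψ Θ : ModuleCat.{u} R ⥤ ModuleCat.{u} R}

theorem of_kernel (α : Φ ⟶ Ψ) (β : Ψ ⟶ Θ) (hΨ : PreservesGood Ψ) (hΘ : PreservesGood Θ)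
    (hα : ∀ Y, Function.Injective (α.app Y)) (h : ∀ Y, Function.Exact (α.app Y) (β.app Y)) :
    PreservesGood Φ := fun _ X hX =>
  .of_kernel (X.homMap α) (X.homMap β) (hΨ X hX) (hΘ X hX) (fun _ => hα _) (fun _ => h _)

theorem of_cokernel (α : Φ ⟶ Ψ) (β : Ψ ⟶ Θ) (hΦ : PreservesGood Φ) (hΨ : PreservesGood Ψ)
    (hβ : ∀ Y, Function.Surjective (β.app Y)) (h : ∀ Y, Function.Exact (α.app Y) (β.app Y)) :
    PreservesGood Θ := fun _ X hX =>
  .of_cokernel (X.homMap α) (X.homMap β) (hΦ X hX) (hΨ X hX) (fun _ => hβ _) (fun _ => h _)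

theorem of_extension (α : Φ ⟶ Ψ) (β : Ψ ⟶ Θ) (hΦ : PreservesGood Φ) (hΘ : PreservesGood Θ)
    (hα : ∀ Y, Function.Injective (α.app Y)) (hβ : ∀ Y, Function.Surjective (β.app Y))
    (h : ∀ Y, Function.Exact (α.app Y) (β.app Y)) :
    PreservesGood Ψ := fun _ X hX =>
  .of_extension (X.homMap α) (X.homMap β) (hΦ X hX) (hΘ X hX) (fun _ => hα _) (fun _ => hβ _)
    (fun _ => h _)

theorem id : PreservesGood (𝟭 (ModuleCat.{u} R)) := fun _ _ hX => hX

theorem of_subsingleton (h : ∀ Y, Subsingleton (Φ.obj Y)) : PreservesGood Φ := by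
  intro r X _
  have (n : ℕ) : Subsingleton ((X.map Φ).obj n) := h _
  exact
    { isFiniteLength n := .of_subsingleton
      ker := DescFam.isArtin_zero.of_surjective (fun _ => 0)
        (fun k n a => (X.map Φ).kerι_injective n (Subsingleton.elim _ _))
        fun n b => ⟨0, (X.map Φ).kerι_injective n (Subsingleton.elim _ _)⟩
      coker := DescFam.isArtin_zero.of_surjective (fun _ => 0) (by simp) fun n b => by
        obtain ⟨b, rfl⟩ := (X.map Φ).cokerπ_surjective n b
        exact ⟨0, by rw [Subsingleton.elim b 0]; simp⟩ }

theorem of_iso (e : Φ ≅ Ψ) (hΦ : PreservesGood Φ) : PreservesGood Ψ := by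
  refine of_cokernel (𝟙 Φ - 𝟙 Φ) e.hom hΦ hΦ ?_ ?_
  · intro Y y
    exact ⟨e.inv.app Y y, by simp⟩
  · intro Y y
    constructor
    · intro h
      have : e.inv.app Y (e.hom.app Y y) = y := by simp
      exact ⟨0, by rw [← this, h]; simp⟩
    · rintro ⟨z, rfl⟩
      simp

end PreservesGood

section ExtMap

variable {R : Type u} [CommRing R]

/-- The map on `Ext` induced by a linear map in the first variable. -/
noncomputable def extMap {A B : ModuleCat.{u} R} (f : A ⟶ B) (M : ModuleCat.{u} R) (p : ℕ) :
    Abelian.Ext B M p →ₗ[R] Abelian.Ext A M p :=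
  (Abelian.Ext.mk₀ f).precompOfLinear R M (zero_add p)

variable {A B C : ModuleCat.{u} R} {M : ModuleCat.{u} R} {p : ℕ}

theorem extMap_apply (f : A ⟶ B) (ξ : Abelian.Ext B M p) :
    extMap f M p ξ = (Abelian.Ext.mk₀ f).comp ξ (zero_add p) := rfl

theorem extMap_id (ξ : Abelian.Ext A M p) : extMap (𝟙 A) M p ξ = ξ := by
  simp [extMap_apply]

theorem extMap_comp (f : A ⟶ B) (g : B ⟶ C) (ξ : Abelian.Ext C M p) :
    extMap (f ≫ g) M p ξ = extMap f M p (extMap g M p ξ) := by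
  simp [extMap_apply]

theorem extMap_comm {B' : ModuleCat.{u} R} {f : A ⟶ B} {g : B ⟶ C} {f' : A ⟶ B'} {g' : B' ⟶ C}
    (h : f ≫ g = f' ≫ g') (ξ : Abelian.Ext C M p) :
    extMap f M p (extMap g M p ξ) = extMap f' M p (extMap g' M p ξ) := by
  rw [← extMap_comp, ← extMap_comp, h]

theorem extMap_add (f g : A ⟶ B) (ξ : Abelian.Ext B M p) :
    extMap (f + g) M p ξ = extMap f M p ξ + extMap g M p ξ := by
  rw [extMap_apply, Abelian.Ext.mk₀_add, Abelian.Ext.add_comp, extMap_apply, extMap_apply]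

theorem extMap_zero (ξ : Abelian.Ext B M p) : extMap (0 : A ⟶ B) M p ξ = 0 := by
  simp [extMap_apply]

theorem extMap_smul (c : R) (f : A ⟶ B) (ξ : Abelian.Ext B M p) :
    extMap (c • f) M p ξ = c • extMap f M p ξ := by
  rw [extMap_apply, Abelian.Ext.mk₀_smul, Abelian.Ext.smul_comp, extMap_apply]

theorem extMap_sum {ι : Type*} (s : Finset ι) (f : ι → (A ⟶ B)) (ξ : Abelian.Ext B M p) :
    extMap (∑ i ∈ s, f i) M p ξ = ∑ i ∈ s, extMap (f i) M p ξ := by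
  classical
  induction s using Finset.induction_on with
  | empty => simp [extMap_zero]
  | insert a s ha ih => rw [Finset.sum_insert ha, Finset.sum_insert ha, extMap_add, ih]

/-- The short exact sequence attached to an injective and a surjective linear map. -/
theorem ModuleCat.shortExact_mk (f : A ⟶ B) (g : B ⟶ C) (hf : Function.Injective f)
    (hg : Function.Surjective g) (h : Function.Exact f g) :
    (ShortComplex.mk f g (by ext a; exact h.apply_apply_eq_zero a)).ShortExact :=
  ModuleCat.shortComplex_shortExact _ h hf hg

theorem exists_extMap_eq (f : A ⟶ B) (g : B ⟶ C) (hf : Function.Injective f)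
    (hg : Function.Surjective g) (h : Function.Exact f g) (ξ : Abelian.Ext B M p)
    (hξ : extMap f M p ξ = 0) : ∃ η, extMap g M p η = ξ :=
  Abelian.Ext.contravariant_sequence_exact₂ (ModuleCat.shortExact_mk f g hf hg h) M ξ hξ

theorem smul_ext_eq_zero_of_mem_annihilator_right {c : R} (hc : c ∈ Module.annihilator R M)
    (ξ : Abelian.Ext A M p) : c • ξ = 0 := by
  have : c • 𝟙 M = 0 := by
    ext a
    exact Module.mem_annihilator.1 hc a
  rw [Abelian.Ext.smul_eq_comp_mk₀, this, Abelian.Ext.mk₀_zero, Abelian.Ext.comp_zero]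

theorem smul_ext_eq_zero_of_mem_annihilator_left {c : R} (hc : c ∈ Module.annihilator R A)
    (ξ : Abelian.Ext A M p) : c • ξ = 0 := by
  have : c • 𝟙 A = 0 := by
    ext a
    exact Module.mem_annihilator.1 hc a
  rw [← extMap_id (c • ξ), map_smul, ← extMap_smul, this, extMap_zero]

end ExtMap

/-- A family of modules with `r` operators raising the degree by one. -/
structure AscFam (R : Type u) [CommRing R] (r : ℕ) where
  /-- The components. -/
  obj : ℕ → ModuleCat.{u} R
  /-- The operators. -/
  x : Fin r → ∀ n, obj n ⟶ obj (n + 1)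

namespace AscFam

variable {R : Type u} [CommRing R] {r : ℕ}

/-- A family of submodules stable under the operators. -/
@[ext]
structure Sub (G : AscFam R r) where
  /-- The components. -/
  carrier : ∀ n, Submodule R (G.obj n)
  stable : ∀ k n, ∀ a ∈ carrier n, G.x k n a ∈ carrier (n + 1)

instance (G : AscFam R r) : PartialOrder G.Sub :=
  PartialOrder.lift Sub.carrier fun _ _ => Sub.ext

/-- The ascending chain condition on stable families of submodules. -/
def IsNoeth (G : AscFam R r) : Prop := WellFoundedGT G.Sub

/-- The family attached to a stable family of submodules. -/
def Sub.toFam {G : AscFam R r} (P : G.Sub) : AscFam R r where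
  obj n := ModuleCat.of R (P.carrier n)
  x k n := ModuleCat.ofHom ((G.x k n).hom.restrict (P.stable k n))

/-- The inclusion of a stable family of submodules. -/
def Sub.ι {G : AscFam R r} (P : G.Sub) (n : ℕ) : P.toFam.obj n ⟶ G.obj n :=
  ModuleCat.ofHom (P.carrier n).subtype

theorem Sub.ι_injective {G : AscFam R r} (P : G.Sub) (n : ℕ) : Function.Injective (P.ι n) :=
  Submodule.subtype_injective _

theorem Sub.x_ι {G : AscFam R r} (P : G.Sub) (k n) :
    P.toFam.x k n ≫ P.ι (n + 1) = P.ι n ≫ G.x k n := rfl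

/-- The quotient by a stable family of submodules. -/
def Sub.quot {G : AscFam R r} (P : G.Sub) : AscFam R r where
  obj n := ModuleCat.of R (G.obj n ⧸ P.carrier n)
  x k n := ModuleCat.ofHom (Submodule.mapQ _ _ (G.x k n).hom (P.stable k n))

/-- The projection to the quotient by a stable family of submodules. -/
def Sub.π {G : AscFam R r} (P : G.Sub) (n : ℕ) : G.obj n ⟶ P.quot.obj n :=
  ModuleCat.ofHom (P.carrier n).mkQ

theorem Sub.π_surjective {G : AscFam R r} (P : G.Sub) (n : ℕ) : Function.Surjective (P.π n) :=
  Submodule.mkQ_surjective _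

theorem Sub.x_π {G : AscFam R r} (P : G.Sub) (k n) :
    G.x k n ≫ P.π (n + 1) = P.π n ≫ P.quot.x k n := rfl

theorem Sub.π_eq_zero_iff {G : AscFam R r} (P : G.Sub) {n : ℕ} {a : G.obj n} :
    P.π n a = 0 ↔ a ∈ P.carrier n := Submodule.Quotient.mk_eq_zero _

theorem Sub.exact {G : AscFam R r} (P : G.Sub) (n : ℕ) : Function.Exact (P.ι n) (P.π n) :=
  LinearMap.exact_subtype_mkQ _

theorem IsNoeth.toFam {G : AscFam R r} (hG : G.IsNoeth) (P : G.Sub) : P.toFam.IsNoeth := by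
  unfold IsNoeth at *
  let φ : P.toFam.Sub → G.Sub := fun Q =>
    ⟨fun n => (Q.carrier n).map (P.ι n).hom, by
      rintro k n _ ⟨a, ha, rfl⟩
      exact ⟨_, Q.stable k n a ha, rfl⟩⟩
  have hφ : StrictMono φ := by
    refine Monotone.strictMono_of_injective (fun Q Q' h n => Submodule.map_mono (h n)) ?_
    intro Q Q' h
    ext1
    funext n
    exact Submodule.map_injective_of_injective (P.ι_injective n)
      (congrFun (congrArg Sub.carrier h) n)
  exact hφ.wellFoundedGT

theorem IsNoeth.quot {G : AscFam R r} (hG : G.IsNoeth) (P : G.Sub) : P.quot.IsNoeth := by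
  unfold IsNoeth at *
  let φ : P.quot.Sub → G.Sub := fun Q =>
    ⟨fun n => (Q.carrier n).comap (P.π n).hom, fun k n a ha => Q.stable k n _ ha⟩
  have hφ : StrictMono φ := by
    refine Monotone.strictMono_of_injective (fun Q Q' h n => Submodule.comap_mono (h n)) ?_
    intro Q Q' h
    ext1
    funext n
    exact Submodule.comap_injective_of_surjective (P.π_surjective n)
      (congrFun (congrArg Sub.carrier h) n)
  exact hφ.wellFoundedGT

/-- The family of homomorphisms to a module. -/
def hom (G : AscFam R r) (E : Type u) [AddCommGroup E] [Module R E] : DescFam R r where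
  obj n := ModuleCat.of R (G.obj n →ₗ[R] E)
  x k n := (G.x k n).hom.lcomp R E

/-- The family of `Ext` modules. -/
noncomputable def ext (G : AscFam R r) (M : ModuleCat.{u} R) (p : ℕ) : DescFam R r where
  obj n := ModuleCat.of R (Abelian.Ext (G.obj n) M p)
  x k n := extMap (G.x k n) M p

theorem ext_isArtin_of_sub {G : AscFam R r} {M : ModuleCat.{u} R} {p : ℕ} (P : G.Sub)
    (h₁ : (P.toFam.ext M p).IsArtin) (h₂ : (P.quot.ext M p).IsArtin) : (G.ext M p).IsArtin := by
  refine h₂.of_exact h₁ (fun n => extMap (P.π n) M p) (fun n => extMap (P.ι n) M p)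
    (fun k n => extMap_comm (P.x_π k n).symm) (fun k n => extMap_comm (P.x_ι k n).symm)
    fun n => exists_extMap_eq _ _ (P.ι_injective n) (P.π_surjective n) (P.exact n)

end AscFam

theorem LinearMap.mem_span_of_isSimpleModule {R A S : Type*} [CommRing R] [AddCommGroup A]
    [Module R A] [AddCommGroup S] [Module R S] [IsSimpleModule R S] (s : Finset (A →ₗ[R] S))
    (φ : A →ₗ[R] S) (h : ∀ a, (∀ ψ ∈ s, ψ a = 0) → φ a = 0) :
    φ ∈ Submodule.span R (s : Set (A →ₗ[R] S)) := by
  classical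
  induction s using Finset.induction_on generalizing φ with
  | empty =>
    have : φ = 0 := LinearMap.ext fun a => h a (by simp)
    simp [this]
  | insert ψ s hψ ih =>
    have hle : Submodule.span R (s : Set (A →ₗ[R] S)) ≤
        Submodule.span R (insert ψ s : Finset (A →ₗ[R] S)) :=
      Submodule.span_mono (by simp)
    by_cases H : ∃ a₀, (∀ θ ∈ s, θ a₀ = 0) ∧ ψ a₀ ≠ 0
    · obtain ⟨a₀, ha₀, hne⟩ := H
      obtain ⟨c, hc⟩ := IsSimpleModule.toSpanSingleton_surjective R hne (φ a₀)
      rw [LinearMap.toSpanSingleton_apply] at hc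
      have : φ - c • ψ ∈ Submodule.span R (s : Set (A →ₗ[R] S)) := by
        refine ih _ fun a ha => ?_
        obtain ⟨d, hd⟩ := IsSimpleModule.toSpanSingleton_surjective R hne (ψ a)
        rw [LinearMap.toSpanSingleton_apply] at hd
        have key : φ (a - d • a₀) = 0 := h _ fun θ hθ => by
          rcases Finset.mem_insert.1 hθ with rfl | hθ
          · rw [map_sub, map_smul, hd, sub_self]
          · rw [map_sub, map_smul, ha θ hθ, ha₀ θ hθ, smul_zero, sub_zero]
        rw [map_sub, map_smul, sub_eq_zero] at key
        rw [LinearMap.sub_apply, LinearMap.smul_apply, key, ← hc, ← hd, smul_comm, sub_self]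
      have hψ : c • ψ ∈ Submodule.span R ((insert ψ s : Finset (A →ₗ[R] S)) : Set (A →ₗ[R] S)) :=
        Submodule.smul_mem _ _ (Submodule.subset_span (by simp))
      simpa using add_mem (hle this) hψ
    · push Not at H
      refine hle (ih φ fun a ha => h a fun θ hθ => ?_)
      rcases Finset.mem_insert.1 hθ with rfl | hθ
      · exact H a ha
      · exact ha θ hθ

namespace AscFam

variable {R : Type u} [CommRing R] {r : ℕ}

theorem hom_isArtin_of_isSimpleModule {G : AscFam R r} (hG : G.IsNoeth)
    (hf : ∀ n, Module.Finite R (G.obj n)) (S : Type u) [AddCommGroup S] [Module R S]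
    [IsSimpleModule R S] : (G.hom S).IsArtin := by
  let perp (P : (G.hom S).Sub) : G.Sub :=
    { carrier n := ⨅ φ : P.carrier n, LinearMap.ker (show G.obj n →ₗ[R] S from φ.1)
      stable k n a ha := by
        rw [Submodule.mem_iInf] at ha ⊢
        exact fun φ => ha ⟨_, P.stable k n _ φ.2⟩ }
  have hperp : Antitone perp := fun P Q h n a ha => by
    simp only [perp, Submodule.mem_iInf] at ha ⊢
    exact fun φ => ha ⟨φ.1, h n φ.2⟩
  have hinj : Function.Injective perp := by
    have key (P Q : (G.hom S).Sub) (h : perp P = perp Q) : P ≤ Q := by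
      intro n φ hφ
      have : IsNoetherian R S := inferInstance
      have : IsNoetherian R (G.obj n →ₗ[R] S) := inferInstance
      obtain ⟨s, hs⟩ := this.noetherian (Q.carrier n)
      rw [← hs]
      refine LinearMap.mem_span_of_isSimpleModule s φ fun a ha => ?_
      have hQ : a ∈ (perp Q).carrier n := by
        simp only [perp, Submodule.mem_iInf]
        rintro ⟨ψ, hψ⟩
        rw [← hs] at hψ
        refine Submodule.span_induction (p := fun ψ _ => (show G.obj n →ₗ[R] S from ψ) a = 0)
          (fun ψ h => ha ψ h) rfl ?_ ?_ hψ
        · intro ψ₁ ψ₂ _ _ h₁ h₂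
          exact (congrArg₂ (· + ·) h₁ h₂).trans (add_zero _)
        · intro c ψ _ h
          exact (congrArg (c • ·) h).trans (smul_zero _)
      rw [← h] at hQ
      simp only [perp, Submodule.mem_iInf] at hQ
      exact hQ ⟨φ, hφ⟩
    exact fun P Q h => le_antisymm (key P Q h) (key Q P h.symm)
  have : WellFoundedGT G.Sub := hG
  have hs : StrictAnti perp := hperp.strictAnti_of_injective hinj
  exact hs.wellFoundedLT

theorem hom_isArtin {G : AscFam R r} (hG : G.IsNoeth)
    (hf : ∀ n, Module.Finite R (G.obj n)) (E : Type u) [AddCommGroup E] [Module R E]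
    (hE : IsFiniteLength R E) : (G.hom E).IsArtin := by
  induction hE with
  | of_subsingleton =>
    rename_i E _ _ _
    refine DescFam.isArtin_zero.of_surjective (fun _ => 0) (by simp) fun n b => ⟨0, ?_⟩
    exact LinearMap.ext fun a => Subsingleton.elim _ _
  | of_simple_quotient h ih =>
    rename_i E _ _ F _
    have h₂ := hom_isArtin_of_isSimpleModule hG hf (E ⧸ F)
    refine ih.of_exact h₂ (fun n => F.subtype.compRight R) (fun n => F.mkQ.compRight R)
      (fun _ _ _ => rfl) (fun _ _ _ => rfl) fun n (φ : G.obj n →ₗ[R] E) hφ => ?_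
    have hφ : F.mkQ.comp φ = 0 := hφ
    have (a : G.obj n) : φ a ∈ F := (Submodule.Quotient.mk_eq_zero _).1 (LinearMap.congr_fun hφ a)
    exact ⟨φ.codRestrict F this, rfl⟩

end AscFam

section FiniteLength

variable {R : Type u} [CommRing R] [IsLocalRing R]

theorem isFiniteLength_of_le_annihilator [IsNoetherianRing R] {A : Type*} [AddCommGroup A]
    [Module R A]
    [Module.Finite R A] {𝔟 : Ideal R} (h𝔟 : IsLocalRing.maximalIdeal R ≤ 𝔟.radical)
    (hA : 𝔟 ≤ Module.annihilator R A) : IsFiniteLength R A := by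
  rcases subsingleton_or_nontrivial (R ⧸ 𝔟) with h | h
  · rw [Ideal.Quotient.subsingleton_iff] at h
    have : Module.annihilator R A = ⊤ := top_le_iff.1 (h ▸ hA)
    have : Subsingleton A := Module.annihilator_eq_top_iff.1 this
    exact .of_subsingleton
  · have : IsLocalRing (R ⧸ 𝔟) := .of_surjective' (Ideal.Quotient.mk 𝔟) Ideal.Quotient.mk_surjective
    have : IsArtinianRing (R ⧸ 𝔟) := by
      rw [isArtinianRing_iff_isNilpotent_maximalIdeal,
        Ideal.FG.isNilpotent_iff_le_nilradical (IsNoetherian.noetherian _)]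
      intro x hx
      obtain ⟨x, rfl⟩ := Ideal.Quotient.mk_surjective x
      have hx : x ∈ IsLocalRing.maximalIdeal R := fun h => hx (h.map _)
      obtain ⟨n, hn⟩ := h𝔟 hx
      exact ⟨n, by rw [← map_pow, Ideal.Quotient.eq_zero_iff_mem.2 hn]; rfl⟩
    have ht : Module.IsTorsionBySet R A 𝔟 := (Module.isTorsionBySet_iff_subset_annihilator R A).2 hA
    let := ht.module
    have : IsScalarTower R (R ⧸ 𝔟) A := ht.isScalarTower
    have : Module.Finite (R ⧸ 𝔟) A := .of_restrictScalars_finite R _ _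
    have : IsArtinian R A :=
      isArtinian_of_surjective_algebraMap (S := R) (R := R ⧸ 𝔟) Ideal.Quotient.mk_surjective
    exact isFiniteLength_iff_isNoetherian_isArtinian.2 ⟨inferInstance, this⟩

/-- The identity of a finite module killed by the maximal ideal is a sum of maps factoring through
the residue field. -/
theorem exists_sum_toSpanSingleton_comp (A : ModuleCat.{u} R) [Module.Finite R A]
    (hA : IsLocalRing.maximalIdeal R ≤ Module.annihilator R A) :
    ∃ (d : ℕ) (f : Fin d → (A ⟶ ModuleCat.of R (R ⧸ IsLocalRing.maximalIdeal R)))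
      (g : Fin d → (ModuleCat.of R (R ⧸ IsLocalRing.maximalIdeal R) ⟶ A)),
      𝟙 A = ∑ i, f i ≫ g i := by
  have ht : Module.IsTorsionBySet R A (IsLocalRing.maximalIdeal R) :=
    (Module.isTorsionBySet_iff_subset_annihilator R A).2 hA
  let := ht.module
  let := Ideal.Quotient.field (IsLocalRing.maximalIdeal R)
  have : IsScalarTower R (R ⧸ IsLocalRing.maximalIdeal R) A := ht.isScalarTower
  have : Module.Finite (R ⧸ IsLocalRing.maximalIdeal R) A := .of_restrictScalars_finite R _ _
  let b := Module.finBasis (R ⧸ IsLocalRing.maximalIdeal R) A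
  refine ⟨_, fun i => ModuleCat.ofHom ((b.coord i).restrictScalars R),
    fun i => ModuleCat.ofHom ((LinearMap.toSpanSingleton _ A (b i)).restrictScalars R), ?_⟩
  ext a
  rw [ModuleCat.hom_sum, LinearMap.sum_apply]
  exact (b.sum_repr a).symm

end FiniteLength

section ExtToHom

variable {R : Type u} [CommRing R]

/-- The map from a cyclic module `R ⧸ 𝔟` picking out an element of a module killed by `𝔟`. -/
def quotientSpan {𝔟 : Ideal R} {A : ModuleCat.{u} R} (hA : 𝔟 ≤ Module.annihilator R A) (a : A) :
    ModuleCat.of R (R ⧸ 𝔟) ⟶ A :=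
  ModuleCat.ofHom (Submodule.liftQ 𝔟 (LinearMap.toSpanSingleton R A a)
    fun _ hc => Module.mem_annihilator.1 (hA hc) a)

variable {𝔟 : Ideal R} {A B : ModuleCat.{u} R} (hA : 𝔟 ≤ Module.annihilator R A)
  (hB : 𝔟 ≤ Module.annihilator R B)

theorem eq_quotientSpan {g : ModuleCat.of R (R ⧸ 𝔟) ⟶ A} :
    g = quotientSpan hA (g (Ideal.Quotient.mk 𝔟 1)) := by
  refine ModuleCat.hom_ext (LinearMap.ext fun c => ?_)
  obtain ⟨c, rfl⟩ := Ideal.Quotient.mk_surjective c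
  calc g (Ideal.Quotient.mk 𝔟 c) = g (c • Ideal.Quotient.mk 𝔟 1) := by
        rw [← Ideal.Quotient.mk_eq_mk, ← Ideal.Quotient.mk_eq_mk, ← Submodule.Quotient.mk_smul,
          smul_eq_mul, mul_one]
    _ = c • g (Ideal.Quotient.mk 𝔟 1) := map_smul g.hom _ _
    _ = _ := rfl

theorem quotientSpan_add (a b : A) :
    quotientSpan hA (a + b) = quotientSpan hA a + quotientSpan hA b := by
  refine ModuleCat.hom_ext (LinearMap.ext fun c => ?_)
  obtain ⟨c, rfl⟩ := Ideal.Quotient.mk_surjective c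
  exact smul_add c a b

theorem quotientSpan_smul (d : R) (a : A) :
    quotientSpan hA (d • a) = d • quotientSpan hA a := by
  refine ModuleCat.hom_ext (LinearMap.ext fun c => ?_)
  obtain ⟨c, rfl⟩ := Ideal.Quotient.mk_surjective c
  exact smul_comm c d a

theorem quotientSpan_comp (f : A ⟶ B) (a : A) :
    quotientSpan hA a ≫ f = quotientSpan hB (f a) := by
  refine ModuleCat.hom_ext (LinearMap.ext fun c => ?_)
  obtain ⟨c, rfl⟩ := Ideal.Quotient.mk_surjective c
  exact map_smul f.hom c a

/-- The pairing between a module killed by `𝔟` and its `Ext` modules, with values in the `Ext`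
modules of `R ⧸ 𝔟`. -/
noncomputable def extToHom (M : ModuleCat.{u} R) (p : ℕ) :
    Abelian.Ext A M p →ₗ[R] A →ₗ[R] Abelian.Ext (ModuleCat.of R (R ⧸ 𝔟)) M p :=
  LinearMap.mk₂ R (fun ξ a => extMap (quotientSpan hA a) M p ξ)
    (fun _ _ _ => map_add _ _ _) (fun _ _ _ => map_smul _ _ _)
    (fun ξ a b => by rw [quotientSpan_add, extMap_add])
    (fun c ξ a => by rw [quotientSpan_smul, extMap_smul])

theorem extToHom_extMap {M : ModuleCat.{u} R} {p : ℕ} (f : A ⟶ B) (ξ : Abelian.Ext B M p) :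
    extToHom hA M p (extMap f M p ξ) = (extToHom hB M p ξ).comp f.hom := by
  ext a
  change extMap _ M p (extMap f M p ξ) = extMap (quotientSpan hB (f a)) M p ξ
  rw [← extMap_comp, quotientSpan_comp]

end ExtToHom

theorem extToHom_injective {R : Type u} [CommRing R] [IsLocalRing R] {A M : ModuleCat.{u} R}
    [Module.Finite R A] (hA : IsLocalRing.maximalIdeal R ≤ Module.annihilator R A) (p : ℕ) :
    Function.Injective (extToHom hA M p) := by
  rw [injective_iff_map_eq_zero]
  intro ξ hξ
  obtain ⟨d, f, g, h⟩ := exists_sum_toSpanSingleton_comp A hA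
  rw [← extMap_id ξ, h, extMap_sum]
  refine Finset.sum_eq_zero fun i _ => ?_
  rw [extMap_comp, eq_quotientSpan hA (g := g i)]
  refine (congrArg _ (LinearMap.congr_fun hξ _)).trans (map_zero _)

namespace AscFam

variable {R : Type u} [CommRing R]

/-- The families of `Ext` modules into `M` satisfy the descending chain condition for all noetherian
families of finite modules killed by `𝔟`. -/
def ExtArtin (r : ℕ) (M : ModuleCat.{u} R) (𝔟 : Ideal R) : Prop :=
  ∀ G : AscFam R r, G.IsNoeth → (∀ n, Module.Finite R (G.obj n)) →
    (∀ n, 𝔟 ≤ Module.annihilator R (G.obj n)) → ∀ p, (G.ext M p).IsArtin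

variable {r : ℕ} {M : ModuleCat.{u} R}

theorem extArtin_maximalIdeal [IsNoetherianRing R] [IsLocalRing R] [Module.Finite R M] :
    ExtArtin r M (IsLocalRing.maximalIdeal R) := by
  intro G hG hf hm p
  let k := ModuleCat.of R (R ⧸ IsLocalRing.maximalIdeal R)
  have hE : IsFiniteLength R (Abelian.Ext k M p) :=
    isFiniteLength_of_le_annihilator Ideal.le_radical fun c hc =>
      Module.mem_annihilator.2 fun ξ => smul_ext_eq_zero_of_mem_annihilator_left
        (by rwa [Ideal.annihilator_quotient]) ξ
  exact (hom_isArtin hG hf _ hE).of_injective (fun n => extToHom (hm n) M p)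
    (fun k n ξ => extToHom_extMap (hm n) (hm (n + 1)) (G.x k n) ξ)
    fun n => extToHom_injective (hm n) p

/-- The family of elements killed by `c`. -/
def torsion (G : AscFam R r) (c : R) : G.Sub where
  carrier n := Submodule.torsionBy R (G.obj n) c
  stable k n a ha := by
    rw [Submodule.mem_torsionBy_iff] at ha ⊢
    rw [← map_smul (G.x k n).hom, ha, map_zero]

/-- The family of multiples of `c`. -/
def multiples (G : AscFam R r) (c : R) : G.Sub where
  carrier n := LinearMap.range (LinearMap.lsmul R (G.obj n) c)
  stable k n := by
    rintro _ ⟨a, rfl⟩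
    exact ⟨G.x k n a, (map_smul (G.x k n).hom c a).symm⟩

theorem mem_torsion {G : AscFam R r} {c : R} {n : ℕ} {a : G.obj n} :
    a ∈ (G.torsion c).carrier n ↔ c • a = 0 := Submodule.mem_torsionBy_iff _ _

theorem le_annihilator_toFam {G : AscFam R r} {𝔟 : Ideal R} {n : ℕ}
    (h : 𝔟 ≤ Module.annihilator R (G.obj n)) (P : G.Sub) :
    𝔟 ≤ Module.annihilator R (P.toFam.obj n) :=
  h.trans (LinearMap.annihilator_le_of_injective _ (P.ι_injective n))

theorem le_annihilator_quot {G : AscFam R r} {𝔟 : Ideal R} {n : ℕ}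
    (h : 𝔟 ≤ Module.annihilator R (G.obj n)) (P : G.Sub) :
    𝔟 ≤ Module.annihilator R (P.quot.obj n) :=
  h.trans (LinearMap.annihilator_le_of_surjective _ (P.π_surjective n))

theorem mem_annihilator_toFam_torsion (G : AscFam R r) (c : R) (n : ℕ) :
    c ∈ Module.annihilator R ((G.torsion c).toFam.obj n) :=
  Module.mem_annihilator.2 fun a => Subtype.ext (mem_torsion.1 a.2)

theorem finite_toFam [IsNoetherianRing R] {G : AscFam R r} (hf : ∀ n, Module.Finite R (G.obj n))
    (P : G.Sub) (n : ℕ) : Module.Finite R (P.toFam.obj n) :=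
  .of_injective (P.ι n).hom (P.ι_injective n)

theorem finite_quot {G : AscFam R r} (hf : ∀ n, Module.Finite R (G.obj n))
    (P : G.Sub) (n : ℕ) : Module.Finite R (P.quot.obj n) :=
  .of_surjective (P.π n).hom (P.π_surjective n)

theorem ExtArtin.of_pow_mem_annihilator [IsNoetherianRing R] {𝔟 : Ideal R} {a : R}
    (h : ExtArtin r M (𝔟 ⊔ Ideal.span {a})) (e : ℕ) {G : AscFam R r} (hG : G.IsNoeth)
    (hf : ∀ n, Module.Finite R (G.obj n)) (h𝔟 : ∀ n, 𝔟 ≤ Module.annihilator R (G.obj n))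
    (ha : ∀ n, a ^ e ∈ Module.annihilator R (G.obj n)) (p : ℕ) : (G.ext M p).IsArtin := by
  induction e generalizing G with
  | zero =>
    refine h G hG hf (fun n => ?_) p
    have : (1 : R) ∈ Module.annihilator R (G.obj n) := by simpa using ha n
    rw [(Ideal.eq_top_iff_one _).2 this]
    exact le_top
  | succ e ih =>
    refine ext_isArtin_of_sub (G.torsion a) ?_ ?_
    · refine h _ (hG.toFam _) (finite_toFam hf _) (fun n => sup_le ?_ ?_) p
      · exact le_annihilator_toFam (h𝔟 n) _
      · rw [Ideal.span_singleton_le_iff_mem]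
        exact mem_annihilator_toFam_torsion _ _ _
    · refine ih (hG.quot _) (finite_quot hf _) (fun n => le_annihilator_quot (h𝔟 n) _) fun n => ?_
      refine Module.mem_annihilator.2 fun b => ?_
      obtain ⟨b, rfl⟩ := (G.torsion a).π_surjective n b
      rw [← map_smul ((G.torsion a).π n).hom]
      refine (Sub.π_eq_zero_iff _).2 (mem_torsion.2 ?_)
      rw [smul_smul, ← pow_succ']
      exact Module.mem_annihilator.1 (ha n) b

theorem ExtArtin.of_sup_span [IsNoetherianRing R] {𝔟 : Ideal R} {a : R}
    (h : ExtArtin r M (𝔟 ⊔ Ideal.span {a})) (ha : a ∈ (𝔟 ⊔ Module.annihilator R M).radical) :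
    ExtArtin r M 𝔟 := by
  intro G hG hf h𝔟 p
  obtain ⟨e, he⟩ := ha
  obtain ⟨b, hb, c, hc, hbc⟩ := Submodule.mem_sup.1 he
  have hmono : Monotone fun s => G.torsion (a ^ s) := monotone_nat_of_le_succ fun s n g hg => by
    rw [mem_torsion] at hg ⊢
    rw [pow_succ', mul_smul, hg, smul_zero]
  have : WellFoundedGT G.Sub := hG
  obtain ⟨s, hs⟩ := WellFoundedGT.monotone_chain_condition ⟨_, hmono⟩
  refine ext_isArtin_of_sub (G.torsion (a ^ s)) ?_ ?_
  · exact h.of_pow_mem_annihilator s (hG.toFam _) (finite_toFam hf _)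
      (fun n => le_annihilator_toFam (h𝔟 n) _) (fun n => mem_annihilator_toFam_torsion _ _ _) p
  · have hQ𝔟 (n) := le_annihilator_quot (h𝔟 n) (G.torsion (a ^ s))
    have hQ := hG.quot (G.torsion (a ^ s))
    have hQf := finite_quot hf (G.torsion (a ^ s))
    have hinj (n) (q : (G.torsion (a ^ s)).quot.obj n) (hq : a ^ e • q = 0) : q = 0 := by
      obtain ⟨g, rfl⟩ := (G.torsion (a ^ s)).π_surjective n q
      rw [← map_smul ((G.torsion (a ^ s)).π n).hom] at hq
      have hq := mem_torsion.1 ((Sub.π_eq_zero_iff _).1 hq)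
      rw [smul_smul, ← pow_add] at hq
      have := congrArg (fun P => P.carrier n) (hs (s + e) (by omega))
      exact (Sub.π_eq_zero_iff _).2 (this.ge (mem_torsion.2 hq))
    generalize (G.torsion (a ^ s)).quot = Q at hQ𝔟 hQ hQf hinj ⊢
    have key : ((Q.multiples (a ^ e)).quot.ext M p).IsArtin := by
      refine h.of_pow_mem_annihilator e (hQ.quot _) (finite_quot hQf _)
        (fun n => le_annihilator_quot (hQ𝔟 n) _) (fun n => Module.mem_annihilator.2 fun q => ?_) p
      obtain ⟨q, rfl⟩ := (Q.multiples (a ^ e)).π_surjective n q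
      rw [← map_smul ((Q.multiples (a ^ e)).π n).hom]
      exact (Sub.π_eq_zero_iff _).2 ⟨q, rfl⟩
    refine key.of_surjective (fun n => extMap ((Q.multiples (a ^ e)).π n) M p)
      (fun k n => extMap_comm (Sub.x_π _ k n).symm) fun n ξ => ?_
    have hex : Function.Exact (a ^ e • 𝟙 (Q.obj n)) ((Q.multiples (a ^ e)).π n) := fun q =>
      Sub.π_eq_zero_iff _
    have hzero (ζ : Abelian.Ext (Q.obj n) M p) : extMap (a ^ e • 𝟙 (Q.obj n)) M p ζ = 0 := by
      rw [extMap_smul, extMap_id, ← hbc, add_smul,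
        smul_ext_eq_zero_of_mem_annihilator_left (hQ𝔟 n hb),
        smul_ext_eq_zero_of_mem_annihilator_right hc, add_zero]
    exact exists_extMap_eq _ _
      ((injective_iff_map_eq_zero (a ^ e • 𝟙 (Q.obj n)).hom).2 (hinj n))
      (Sub.π_surjective _ n) hex ξ (hzero ξ)

theorem extArtin_of_radical [IsNoetherianRing R] [IsLocalRing R] [Module.Finite R M] {J : Ideal R}
    (hJ : J ≤ IsLocalRing.maximalIdeal R)
    (h : IsLocalRing.maximalIdeal R ≤ (J ⊔ Module.annihilator R M).radical) :
    ExtArtin r M J := by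
  classical
  obtain ⟨s, hs⟩ := IsNoetherian.noetherian (IsLocalRing.maximalIdeal R)
  have key (t : Finset R) (ht : t ⊆ s) (H : ExtArtin r M (J ⊔ Ideal.span t)) : ExtArtin r M J := by
    induction t using Finset.induction_on with
    | empty => simpa using H
    | insert a t _ ih =>
      rw [Finset.insert_subset_iff] at ht
      refine ih ht.2 (ExtArtin.of_sup_span (a := a) ?_ ?_)
      · rwa [sup_assoc, sup_comm (Ideal.span (t : Set R)), ← Ideal.span_insert,
          ← Finset.coe_insert]
      · have : a ∈ IsLocalRing.maximalIdeal R := hs ▸ Submodule.subset_span ht.1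
        exact Ideal.radical_mono (sup_le_sup_right le_sup_left _) (h this)
  refine key s subset_rfl ?_
  have : J ⊔ Ideal.span s = IsLocalRing.maximalIdeal R := by
    rw [Ideal.span, hs]
    exact sup_eq_right.2 hJ
  rw [this]
  exact extArtin_maximalIdeal

end AscFam

section QuotPow

variable {R : Type u} [CommRing R] {r : ℕ} {I : Ideal R}

/-- The modules `N ⧸ Iⁿ N`, with multiplication by elements of `I` as operators. -/
def AscFam.quotPow (N : Type u) [AddCommGroup N] [Module R N] (y : Fin r → I) : AscFam R r where
  obj n := ModuleCat.of R (N ⧸ (I ^ n • ⊤ : Submodule R N))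
  x k n := ModuleCat.ofHom (Submodule.mapQ _ _ (LinearMap.lsmul R N (y k)) (by
    intro a ha
    rw [Submodule.mem_comap, pow_succ', mul_smul]
    exact Submodule.smul_mem_smul (y k).2 ha))

theorem pow_succ_smul_top_le (I : Ideal R) (N : Type u) [AddCommGroup N] [Module R N] (n : ℕ) :
    (I ^ (n + 1) • ⊤ : Submodule R N) ≤ I ^ n • ⊤ :=
  Submodule.smul_mono_left (Ideal.pow_le_pow_right n.le_succ)

/-- The projection `N ⧸ Iⁿ⁺¹ N → N ⧸ Iⁿ N`. -/
def quotPowProj (I : Ideal R) (N : Type u) [AddCommGroup N] [Module R N] (n : ℕ) :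
    ModuleCat.of R (N ⧸ (I ^ (n + 1) • ⊤ : Submodule R N)) ⟶
      ModuleCat.of R (N ⧸ (I ^ n • ⊤ : Submodule R N)) :=
  ModuleCat.ofHom (Submodule.factor (pow_succ_smul_top_le I N n))

variable {N : Type u} [AddCommGroup N] [Module R N] {y : Fin r → I}

theorem quotPowProj_surjective (n : ℕ) : Function.Surjective (quotPowProj I N n) :=
  Submodule.factor_surjective (pow_succ_smul_top_le I N n)

theorem quotPow_x_proj (k : Fin r) (n : ℕ) :
    (AscFam.quotPow N y).x k (n + 1) ≫ quotPowProj I N (n + 1) =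
      quotPowProj I N n ≫ (AscFam.quotPow N y).x k n := by
  ext a
  obtain ⟨a, rfl⟩ := Submodule.Quotient.mk_surjective _ a
  rfl

theorem quotPow_x_comm (k l : Fin r) (n : ℕ) :
    (AscFam.quotPow N y).x k n ≫ (AscFam.quotPow N y).x l (n + 1) =
      (AscFam.quotPow N y).x l n ≫ (AscFam.quotPow N y).x k (n + 1) := by
  ext a
  obtain ⟨a, rfl⟩ := Submodule.Quotient.mk_surjective _ a
  exact congrArg (Submodule.Quotient.mk) (smul_comm (y l : R) (y k : R) a)

variable (N y) in
/-- The modules `N ⧸ Iⁿ⁺¹ N`, with multiplication by elements of `I` as operators. -/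
def AscFam.quotPowSucc : AscFam R r where
  obj n := (AscFam.quotPow N y).obj (n + 1)
  x k n := (AscFam.quotPow N y).x k (n + 1)

variable (N y) in
/-- The submodules `Iⁿ N ⧸ Iⁿ⁺¹ N` of `N ⧸ Iⁿ⁺¹ N`. -/
def AscFam.grSub : (AscFam.quotPowSucc N y).Sub where
  carrier n := LinearMap.ker (quotPowProj I N n).hom
  stable k n a ha := by
    have h : quotPowProj I N (n + 1) ((AscFam.quotPow N y).x k (n + 1) a) =
      (AscFam.quotPow N y).x k n (quotPowProj I N n a) := congr($(quotPow_x_proj k n) a)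
    exact h.trans ((congrArg ((AscFam.quotPow N y).x k n) ha).trans (map_zero _))

theorem mk_mem_grSub {n : ℕ} {a : N} (ha : a ∈ (I ^ n • ⊤ : Submodule R N)) :
    (Submodule.Quotient.mk a : N ⧸ (I ^ (n + 1) • ⊤ : Submodule R N)) ∈
      (AscFam.grSub N y).carrier n :=
  (Submodule.Quotient.mk_eq_zero _).2 ha

/-- The component of the associated graded module, as a quotient map. -/
def grMk (y : Fin r → I) (n : ℕ) :
    (I ^ n • ⊤ : Submodule R N) →ₗ[R] (AscFam.grSub N y).toFam.obj n :=
  LinearMap.codRestrict _ ((Submodule.mkQ _).comp (Submodule.subtype _))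
    fun a => mk_mem_grSub (y := y) a.2

theorem grMk_surjective (n : ℕ) : Function.Surjective (grMk (N := N) y n) := by
  rintro ⟨a, ha⟩
  obtain ⟨a, rfl⟩ := Submodule.Quotient.mk_surjective _ a
  exact ⟨⟨a, (Submodule.Quotient.mk_eq_zero _).1 ha⟩, rfl⟩

theorem grMk_eq_zero {n : ℕ} (a : (I ^ n • ⊤ : Submodule R N))
    (ha : (a : N) ∈ (I ^ (n + 1) • ⊤ : Submodule R N)) : grMk y n a = 0 :=
  Subtype.ext ((Submodule.Quotient.mk_eq_zero _).2 ha)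

theorem grMk_smul {n : ℕ} (k : Fin r) (a : (I ^ n • ⊤ : Submodule R N))
    (h : (y k : R) • (a : N) ∈ (I ^ (n + 1) • ⊤ : Submodule R N)) :
    grMk y (n + 1) ⟨_, h⟩ = (AscFam.grSub N y).toFam.x k n (grMk y n a) := rfl

/-- The preimage of a stable family of submodules of the associated graded module. -/
def grFiltration (hy : Submodule.span R (Set.range fun k => (y k : R)) = I)
    (P : (AscFam.grSub N y).toFam.Sub) : I.Filtration N where
  N n := ((P.carrier n).comap (grMk y n)).map (Submodule.subtype _)
  mono n := by
    rintro _ ⟨a, -, rfl⟩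
    refine ⟨⟨a, pow_succ_smul_top_le I N n a.2⟩, ?_, rfl⟩
    rw [SetLike.mem_coe, Submodule.mem_comap, grMk_eq_zero _ a.2]
    exact zero_mem _
  smul_le n := by
    rw [Submodule.smul_le]
    rintro c hc _ ⟨a, ha, rfl⟩
    replace hc := hy.ge hc
    induction hc using Submodule.span_induction with
    | mem c hc =>
      obtain ⟨k, rfl⟩ := hc
      have h : (y k : R) • (a : N) ∈ (I ^ (n + 1) • ⊤ : Submodule R N) := by
        rw [pow_succ', mul_smul]
        exact Submodule.smul_mem_smul (y k).2 a.2
      refine ⟨⟨_, h⟩, ?_, rfl⟩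
      rw [SetLike.mem_coe, Submodule.mem_comap, grMk_smul]
      exact P.stable k n _ ha
    | zero => rw [zero_smul]; exact zero_mem _
    | add c d _ _ hc hd => rw [add_smul]; exact add_mem hc hd
    | smul d c _ hc => rw [smul_assoc]; exact Submodule.smul_mem _ _ hc

theorem mem_grFiltration (hy : Submodule.span R (Set.range fun k => (y k : R)) = I)
    (P : (AscFam.grSub N y).toFam.Sub) {n : ℕ} (a : (I ^ n • ⊤ : Submodule R N)) :
    (a : N) ∈ (grFiltration hy P).N n ↔ grMk y n a ∈ P.carrier n := by
  constructor
  · rintro ⟨b, hb, h⟩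
    rwa [← Subtype.ext h]
  · exact fun h => ⟨a, h, rfl⟩

theorem Ideal.Filtration.mem_iff_single_mem (F : I.Filtration N) (n : ℕ) (a : N) :
    PolynomialModule.single R n a ∈ F.submodule ↔ a ∈ F.N n := by
  rw [Ideal.Filtration.mem_submodule]
  constructor
  · intro h
    simpa using h n
  · intro h i
    rw [PolynomialModule.coeff_single, Finsupp.single_apply]
    split_ifs with e
    · exact e ▸ h
    · exact zero_mem _

theorem isNoeth_gr [IsNoetherianRing R] [Module.Finite R N]
    (hy : Submodule.span R (Set.range fun k => (y k : R)) = I) :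
    (AscFam.grSub N y).toFam.IsNoeth := by
  let S : Submodule (reesAlgebra I) (PolynomialModule R N) := (I.stableFiltration ⊤).submodule
  have hS : IsNoetherian (reesAlgebra I) S :=
    isNoetherian_of_fg_of_noetherian _ (((I.stableFiltration ⊤).submodule_fg_iff_stable
      fun i => IsNoetherian.noetherian _).2 (I.stableFiltration_stable ⊤))
  let φ : (AscFam.grSub N y).toFam.Sub → Submodule (reesAlgebra I) S := fun P =>
    (grFiltration hy P).submodule.comap S.subtype
  have key : ∀ P P', φ P ≤ φ P' → P ≤ P' := by
    intro P P' h n b hb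
    obtain ⟨a, rfl⟩ := grMk_surjective n b
    rw [← mem_grFiltration hy, ← Ideal.Filtration.mem_iff_single_mem]
    refine h (x := ⟨PolynomialModule.single R n (a : N),
      (Ideal.Filtration.mem_iff_single_mem _ _ _).2 a.2⟩) ?_
    exact (Ideal.Filtration.mem_iff_single_mem _ _ _).2 ((mem_grFiltration hy P a).2 hb)
  have mono : Monotone φ := by
    rintro P P' h ⟨f, hf⟩ hf' i
    obtain ⟨a, ha, h'⟩ := hf' i
    exact ⟨a, h i ha, h'⟩
  have : StrictMono φ := mono.strictMono_of_injective fun P P' h =>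
    le_antisymm (key _ _ h.le) (key _ _ h.ge)
  exact this.wellFoundedGT

theorem finite_gr [IsNoetherianRing R] [Module.Finite R N] (n : ℕ) :
    Module.Finite R ((AscFam.grSub N y).toFam.obj n) :=
  Module.Finite.of_surjective (grMk y n) (grMk_surjective n)

theorem le_annihilator_gr (n : ℕ) :
    I ⊔ Module.annihilator R N ≤ Module.annihilator R ((AscFam.grSub N y).toFam.obj n) := by
  refine sup_le ?_ ?_ <;> intro c hc <;> rw [Module.mem_annihilator] <;> intro b <;>
    obtain ⟨a, rfl⟩ := grMk_surjective n b <;> rw [← map_smul]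
  · refine grMk_eq_zero _ ?_
    rw [pow_succ', mul_smul]
    exact Submodule.smul_mem_smul hc a.2
  · rw [show c • a = 0 from Subtype.ext (Module.mem_annihilator.1 hc _), map_zero]

end QuotPow

section ExtDelta

variable {R : Type u} [CommRing R] {A B C A' B' C' M : ModuleCat.{u} R} {p : ℕ}

/-- The connecting map of the long exact sequence of `Ext` in the first variable. -/
noncomputable def extDelta {S : ShortComplex (ModuleCat.{u} R)} (hS : S.ShortExact)
    (M : ModuleCat.{u} R) (p : ℕ) : Abelian.Ext S.X₁ M p →ₗ[R] Abelian.Ext S.X₃ M (p + 1) :=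
  hS.extClass.precompOfLinear R M (add_comm 1 p)

variable {S S' : ShortComplex (ModuleCat.{u} R)}

theorem extMap_extDelta (hS : S.ShortExact) (ξ : Abelian.Ext S.X₁ M p) :
    extMap S.g M (p + 1) (extDelta hS M p ξ) = 0 :=
  hS.comp_extClass_assoc _ (add_comm 1 p)

theorem exists_extDelta_eq (hS : S.ShortExact) (ξ : Abelian.Ext S.X₃ M (p + 1))
    (hξ : extMap S.g M (p + 1) ξ = 0) : ∃ η, extDelta hS M p η = ξ :=
  Abelian.Ext.contravariant_sequence_exact₃ hS M ξ hξ (add_comm 1 p)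

theorem extMap_extDelta_naturality (hS : S.ShortExact) (hS' : S'.ShortExact) (φ : S ⟶ S')
    (ξ : Abelian.Ext S'.X₁ M p) :
    extMap φ.τ₃ M (p + 1) (extDelta hS' M p ξ) = extDelta hS M p (extMap φ.τ₁ M p ξ) := by
  have := ShortComplex.ShortExact.extClass_naturality hS hS' φ
  simp only [extMap_apply, extDelta, Abelian.Ext.bilinearCompOfLinear_apply_apply]
  rw [← Abelian.Ext.comp_assoc (a₁₂ := 1) _ _ _ (by lia) (by lia) (by lia), ← this,
    ← Abelian.Ext.comp_assoc (a₁₂ := 1) _ _ _ (by lia) (by lia) (by lia)]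

theorem extMap_extMap_eq_zero {f : A ⟶ B} {g : B ⟶ C} (h : f ≫ g = 0) (ξ : Abelian.Ext C M p) :
    extMap f M p (extMap g M p ξ) = 0 := by
  rw [← extMap_comp, h, extMap_zero]

theorem extMap_zero_injective (f : A ⟶ B) (hf : Function.Surjective f) :
    Function.Injective (extMap f M 0) := by
  have : Epi f := (ModuleCat.epi_iff_surjective f).2 hf
  exact Abelian.Ext.precomp_mk₀_injective_of_epi M f

end ExtDelta

section ExtQuotPow

variable {R : Type u} [CommRing R] {r : ℕ} {I : Ideal R} {N : Type u} [AddCommGroup N] [Module R N]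
  {y : Fin r → I} {M : ModuleCat.{u} R} {p : ℕ}

variable (N y M p) in
/-- The modules `Ext (N ⧸ Iⁿ N) M`, with multiplication by elements of `I` and the projections
as operators. -/
noncomputable def extQuotPow : ReesFam R r where
  obj n := ModuleCat.of R (Abelian.Ext ((AscFam.quotPow N y).obj n) M p)
  x k n := ModuleCat.ofHom (extMap ((AscFam.quotPow N y).x k n) M p)
  t n := ModuleCat.ofHom (extMap (quotPowProj I N n) M p)
  x_comm k l n := by
    ext ξ
    exact extMap_comm (quotPow_x_comm k l n) ξ
  t_comm k n := by
    ext ξ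
    exact extMap_comm (quotPow_x_proj k n).symm ξ

theorem grSub_exact (n : ℕ) :
    Function.Exact ((AscFam.grSub N y).ι n) (quotPowProj I N n) :=
  LinearMap.exact_subtype_ker_map _

variable (y) in
theorem grSub_ι_proj (n : ℕ) : (AscFam.grSub N y).ι n ≫ quotPowProj I N n = 0 := by
  ext a
  exact (grSub_exact n).apply_apply_eq_zero a

variable (y) in
theorem shortExact_gr (n : ℕ) :
    (ShortComplex.mk ((AscFam.grSub N y).ι n) (quotPowProj I N n)
      (grSub_ι_proj y n)).ShortExact :=
  ModuleCat.shortExact_mk _ _ ((AscFam.grSub N y).ι_injective n) (quotPowProj_surjective n)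
    (grSub_exact n)

theorem isArtin_coker_extQuotPow (h : ((AscFam.grSub N y).toFam.ext M p).IsArtin) :
    (extQuotPow N y M p).coker.IsArtin := by
  refine h.of_injective (fun n => Submodule.liftQ _ (extMap ((AscFam.grSub N y).ι n) M p) ?_) ?_ ?_
  · rintro _ ⟨ξ, rfl⟩
    exact extMap_extMap_eq_zero (grSub_ι_proj y n) ξ
  · intro k n ξ
    obtain ⟨ξ, rfl⟩ := Submodule.Quotient.mk_surjective _ ξ
    exact extMap_comm ((AscFam.grSub N y).x_ι k n).symm ξ
  · intro n
    exact LinearMap.ker_eq_bot.1 (Submodule.ker_liftQ_eq_bot _ _ _ fun ξ hξ =>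
      exists_extMap_eq _ _ ((AscFam.grSub N y).ι_injective n) (quotPowProj_surjective n)
        (grSub_exact n) ξ hξ)

/-- Multiplication by an element of `I`, as a morphism of short exact sequences. -/
def grShortComplexMap (k : Fin r) (n : ℕ) :
    ShortComplex.mk ((AscFam.grSub N y).ι n) (quotPowProj I N n) (grSub_ι_proj y n) ⟶
      ShortComplex.mk ((AscFam.grSub N y).ι (n + 1)) (quotPowProj I N (n + 1))
        (grSub_ι_proj y (n + 1)) where
  τ₁ := (AscFam.grSub N y).toFam.x k n
  τ₂ := (AscFam.quotPow N y).x k (n + 1)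
  τ₃ := (AscFam.quotPow N y).x k n
  comm₁₂ := (AscFam.grSub N y).x_ι k n
  comm₂₃ := quotPow_x_proj k n

theorem isArtin_ker_extQuotPow_zero : (extQuotPow N y M 0).ker.IsArtin := by
  refine DescFam.isArtin_zero.of_injective (fun _ => 0) (by simp) fun n ξ η _ => ?_
  apply ReesFam.kerι_injective
  apply extMap_zero_injective (M := M) (quotPowProj I N n) (quotPowProj_surjective n)
  exact (ReesFam.t_kerι _ _ ξ).trans (ReesFam.t_kerι _ _ η).symm

theorem isArtin_ker_extQuotPow_succ (h : ((AscFam.grSub N y).toFam.ext M p).IsArtin) :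
    (extQuotPow N y M (p + 1)).ker.IsArtin := by
  refine h.of_surjective (fun n => LinearMap.codRestrict _ (extDelta (shortExact_gr y n) M p)
    fun ξ => extMap_extDelta (shortExact_gr y n) ξ) ?_ ?_
  · intro k n ξ
    exact Subtype.ext (extMap_extDelta_naturality (shortExact_gr y n) (shortExact_gr y (n + 1))
      (grShortComplexMap k n) ξ).symm
  · rintro n ⟨ξ, hξ⟩
    obtain ⟨η, hη⟩ := exists_extDelta_eq (shortExact_gr y n) ξ hξ
    exact ⟨η, Subtype.ext hη⟩

theorem pow_le_annihilator_quotPow (n : ℕ) :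
    I ^ n ⊔ Module.annihilator R N ≤ Module.annihilator R ((AscFam.quotPow N y).obj n) := by
  refine sup_le ?_ ?_ <;> intro c hc <;> rw [Module.mem_annihilator] <;> intro b <;>
    obtain ⟨a, rfl⟩ := Submodule.Quotient.mk_surjective _ b <;>
    refine (Submodule.Quotient.mk_eq_zero _ (x := c • a)).2 ?_
  · exact Submodule.smul_mem_smul hc trivial
  · rw [Module.mem_annihilator.1 hc]
    exact zero_mem _

theorem isGood_extQuotPow [IsNoetherianRing R] [IsLocalRing R] [Module.Finite R N]
    [Module.Finite R M] (hy : Submodule.span R (Set.range fun k => (y k : R)) = I)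
    (hI : (I + Module.annihilator R M + Module.annihilator R N).radical =
      IsLocalRing.maximalIdeal R) (p : ℕ) :
    (extQuotPow N y M p).IsGood := by
  have hart : AscFam.ExtArtin r M (I ⊔ Module.annihilator R N) := by
    refine AscFam.extArtin_of_radical ?_ ?_
    · rw [← hI]
      refine le_trans ?_ Ideal.le_radical
      rw [Ideal.add_eq_sup, Ideal.add_eq_sup]
      exact sup_le (le_sup_left.trans le_sup_left) le_sup_right
    · rw [← hI, Ideal.add_eq_sup, Ideal.add_eq_sup, sup_right_comm]
  have hgr := hart _ (isNoeth_gr hy) (finite_gr (y := y)) (le_annihilator_gr (y := y))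
  refine ⟨fun n => ?_, ?_, isArtin_coker_extQuotPow (hgr p)⟩
  · have : Module.Finite R ((AscFam.quotPow N y).obj n) :=
      Module.Finite.of_surjective (Submodule.mkQ _) (Submodule.mkQ_surjective _)
    have := ModuleCat.finite_ext R ((AscFam.quotPow N y).obj n) M p
    change IsFiniteLength R (Abelian.Ext ((AscFam.quotPow N y).obj n) M p)
    refine isFiniteLength_of_le_annihilator
      (𝔟 := I ^ n ⊔ Module.annihilator R N ⊔ Module.annihilator R M) ?_ (sup_le ?_ ?_)
    · rw [← hI, Ideal.add_eq_sup, Ideal.add_eq_sup, sup_right_comm, sup_assoc, sup_assoc]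
      cases n with
      | zero =>
        rw [pow_zero, Ideal.one_eq_top, top_sup_eq]
        exact Ideal.radical_mono le_top
      | succ n =>
        rw [Ideal.radical_sup, Ideal.radical_sup (I ^ (n + 1)), Ideal.radical_pow _ n.succ_ne_zero]
    · exact fun c hc => Module.mem_annihilator.2 fun ξ =>
        smul_ext_eq_zero_of_mem_annihilator_left (pow_le_annihilator_quotPow n hc) ξ
    · exact fun c hc => Module.mem_annihilator.2 fun ξ =>
        smul_ext_eq_zero_of_mem_annihilator_right hc ξ
  · cases p with
    | zero => exact isArtin_ker_extQuotPow_zero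
    | succ p => exact isArtin_ker_extQuotPow_succ (hgr p)

end ExtQuotPow

section ExtFunctor

variable {R : Type u} [CommRing R] {j : ℕ}

/-- The functor `Ext L -` as a functor to modules. -/
noncomputable def extFunctorModule (L : ModuleCat.{u} R) (j : ℕ) :
    ModuleCat.{u} R ⥤ ModuleCat.{u} R where
  obj Y := ModuleCat.of R (Abelian.Ext L Y j)
  map f := ModuleCat.ofHom ((Abelian.Ext.mk₀ f).postcompOfLinear R L (add_zero j))
  map_id Y := by
    ext ξ
    exact Abelian.Ext.comp_mk₀_id ξ
  map_comp f g := by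
    ext ξ
    simp

/-- Functoriality of `Ext` in the first variable. -/
noncomputable def extFunctorModuleMap {L L' : ModuleCat.{u} R} (f : L ⟶ L') (j : ℕ) :
    extFunctorModule L' j ⟶ extFunctorModule L j where
  app Y := ModuleCat.ofHom (extMap f Y j)
  naturality Y Y' g := by
    ext ξ
    exact (Abelian.Ext.comp_assoc_of_third_deg_zero (Abelian.Ext.mk₀ f) ξ (Abelian.Ext.mk₀ g)
      (zero_add j)).symm

/-- The connecting map of the long exact sequence of `Ext`, as a natural transformation. -/
noncomputable def extFunctorModuleDelta {S : ShortComplex (ModuleCat.{u} R)} (hS : S.ShortExact)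
    (j : ℕ) : extFunctorModule S.X₁ j ⟶ extFunctorModule S.X₃ (j + 1) where
  app Y := ModuleCat.ofHom (extDelta hS Y j)
  naturality Y Y' g := by
    ext ξ
    exact (Abelian.Ext.comp_assoc_of_third_deg_zero hS.extClass ξ (Abelian.Ext.mk₀ g)
      (add_comm 1 j)).symm

/-- `Hom R -` is the identity. -/
noncomputable def extFunctorModuleIso (R : Type u) [CommRing R] :
    𝟭 (ModuleCat.{u} R) ≅ extFunctorModule (ModuleCat.of R R) 0 :=
  NatIso.ofComponents (fun Y => LinearEquiv.toModuleIso
    ((LinearMap.ringLmapEquivSelf R R Y).symm ≪≫ₗ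
      (ModuleCat.homLinearEquiv (S := R) (M := ModuleCat.of R R) (N := Y)).symm ≪≫ₗ
      (Abelian.Ext.linearEquiv₀ (R := R)).symm)) (by
    intro Y Y' f
    ext y
    change Abelian.Ext.mk₀ _ = (Abelian.Ext.mk₀ _).comp (Abelian.Ext.mk₀ f) (add_zero 0)
    rw [Abelian.Ext.mk₀_comp_mk₀]
    congr 1
    ext
    exact (one_smul R (f y)).trans (congrArg f (one_smul R y)).symm)

theorem shortExact_pi (R : Type u) [CommRing R] (b : ℕ) :
    ∃ (f : ModuleCat.of R (Fin b → R) ⟶ ModuleCat.of R (Fin (b + 1) → R))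
      (g : ModuleCat.of R (Fin (b + 1) → R) ⟶ ModuleCat.of R R) (w : f ≫ g = 0),
      (ShortComplex.mk f g w).ShortExact := by
  refine ⟨ModuleCat.ofHom (LinearMap.vecCons 0 LinearMap.id),
    ModuleCat.ofHom (LinearMap.proj 0), _, ModuleCat.shortExact_mk _ _ ?_ ?_ ?_⟩
  · intro v w h
    exact funext fun i => congrFun h i.succ
  · exact fun c => ⟨fun _ => c, rfl⟩
  · intro v
    constructor
    · intro h
      refine ⟨Fin.tail v, ?_⟩
      rw [← Fin.cons_self_tail v]
      exact congrArg (Fin.cons · (Fin.tail v)) h.symm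
    · rintro ⟨w, rfl⟩
      rfl

theorem exists_shortExact_finite [IsNoetherianRing R] (L : ModuleCat.{u} R) [Module.Finite R L] :
    ∃ (b : ℕ) (L' : ModuleCat.{u} R) (_ : Module.Finite R L') (f : L' ⟶ ModuleCat.of R (Fin b → R))
      (g : ModuleCat.of R (Fin b → R) ⟶ L) (w : f ≫ g = 0), (ShortComplex.mk f g w).ShortExact := by
  obtain ⟨b, g, hg⟩ := Module.Finite.exists_fin' R L
  exact ⟨b, ModuleCat.of R (LinearMap.ker g), inferInstance,
    ModuleCat.ofHom (LinearMap.ker g).subtype,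
    ModuleCat.ofHom g, _, ModuleCat.shortExact_mk _ _ (Submodule.subtype_injective _) hg
      (LinearMap.exact_subtype_ker_map g)⟩

instance projective_pi (b : ℕ) : Projective (ModuleCat.of R (Fin b → R)) :=
  ModuleCat.projective_of_free (Pi.basisFun R (Fin b))

theorem extMap_comp_exact {S : ShortComplex (ModuleCat.{u} R)} (hS : S.ShortExact)
    (Y : ModuleCat.{u} R) : Function.Exact (extMap S.g Y j) (extMap S.f Y j) := by
  intro ξ
  constructor
  · exact Abelian.Ext.contravariant_sequence_exact₂ hS Y ξ
  · rintro ⟨η, rfl⟩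
    exact extMap_extMap_eq_zero S.zero η

theorem extMap_extDelta_exact {S : ShortComplex (ModuleCat.{u} R)} (hS : S.ShortExact)
    (Y : ModuleCat.{u} R) : Function.Exact (extMap S.f Y j) (extDelta hS Y j) := by
  intro ξ
  constructor
  · exact Abelian.Ext.contravariant_sequence_exact₁ hS Y ξ (add_comm 1 j)
  · rintro ⟨η, rfl⟩
    exact hS.extClass_comp_assoc η (h := add_comm 1 j)

theorem preservesGood_ext_pi (j b : ℕ) :
    PreservesGood (extFunctorModule (ModuleCat.of R (Fin b → R)) j) := by
  cases j with
  | zero =>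
    induction b with
    | zero => exact .of_subsingleton fun Y =>
        (Abelian.Ext.linearEquiv₀ (R := R)).toEquiv.trans ModuleCat.homEquiv |>.subsingleton
    | succ b ih =>
      obtain ⟨f, g, w, h⟩ := shortExact_pi R b
      refine .of_extension (extFunctorModuleMap g 0) (extFunctorModuleMap f 0)
        (.of_iso (extFunctorModuleIso R) .id) ih
        (fun Y => extMap_zero_injective g h.moduleCat_surjective_g) (fun Y ξ => ?_)
        (extMap_comp_exact h)
      have : Projective (ModuleCat.of R R) :=
        ModuleCat.projective_of_free (Module.Basis.singleton Unit R)
      exact (extMap_extDelta_exact h Y ξ).1 (Abelian.Ext.eq_zero_of_projective _)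
  | succ j => exact .of_subsingleton fun Y => Abelian.Ext.subsingleton_of_projective _ _ _

theorem preservesGood_ext [IsNoetherianRing R] (L : ModuleCat.{u} R) [Module.Finite R L] (j : ℕ) :
    PreservesGood (extFunctorModule L j) := by
  induction j generalizing L with
  | zero =>
    obtain ⟨b, L', _, f, g, w, h⟩ := exists_shortExact_finite L
    obtain ⟨b', L'', _, f', g', w', h'⟩ := exists_shortExact_finite L'
    refine .of_kernel (extFunctorModuleMap g 0) (extFunctorModuleMap (g' ≫ f) 0)
      (preservesGood_ext_pi 0 b) (preservesGood_ext_pi 0 b')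
      (fun Y => extMap_zero_injective g h.moduleCat_surjective_g) fun Y ξ => ?_
    refine Iff.trans ⟨fun hξ => ?_, fun hξ => ?_⟩ (extMap_comp_exact h Y ξ)
    · refine extMap_zero_injective g' h'.moduleCat_surjective_g ?_
      exact ((extMap_comp g' f ξ).symm.trans hξ).trans (map_zero _).symm
    · exact (extMap_comp g' f ξ).trans ((congrArg _ hξ).trans (map_zero _))
  | succ j ih =>
    obtain ⟨b, L', _, f, g, w, h⟩ := exists_shortExact_finite L
    exact .of_cokernel (extFunctorModuleMap f j) (extFunctorModuleDelta h j)
      (preservesGood_ext_pi j b) (ih L')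
      (fun Y => precomp_extClass_surjective_of_projective_X₂ Y h j) (extMap_extDelta_exact h)

end ExtFunctor

section TorFunctor

open MonoidalCategory Limits

variable {R : Type u} [CommRing R]

theorem tensor_map_exact {S : ShortComplex (ModuleCat.{u} R)} (hS : S.ShortExact)
    (Y : ModuleCat.{u} R) : Function.Exact (S.f ▷ Y) (S.g ▷ Y) := by
  have h := hS.exact
  rw [ShortComplex.ShortExact.moduleCat_exact_iff_function_exact] at h
  exact rTensor_exact Y h hS.moduleCat_surjective_g

theorem tensor_map_surjective {S : ShortComplex (ModuleCat.{u} R)} (hS : S.ShortExact)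
    (Y : ModuleCat.{u} R) : Function.Surjective (S.g ▷ Y) :=
  LinearMap.rTensor_surjective Y hS.moduleCat_surjective_g

theorem tensor_map_injective_of_flat {S : ShortComplex (ModuleCat.{u} R)} (hS : S.ShortExact)
    (Y : ModuleCat.{u} R) [Module.Flat R Y] : Function.Injective (S.f ▷ Y) :=
  Module.Flat.rTensor_preserves_injective_linearMap _ hS.moduleCat_injective_f

theorem tensor_map_injective_of_projective {S : ShortComplex (ModuleCat.{u} R)}
    (hS : S.ShortExact) [Projective S.X₃] (Y : ModuleCat.{u} R) :
    Function.Injective (S.f ▷ Y) := by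
  let s : S.Splitting := hS.splittingOfProjective
  refine Function.LeftInverse.injective (g := s.r ▷ Y) fun y => ?_
  have : S.f ▷ Y ≫ s.r ▷ Y = 𝟙 _ := by
    rw [← comp_whiskerRight, s.f_r, id_whiskerRight]
  exact ConcreteCategory.congr_hom this y

theorem preservesGood_tensor_pi (b : ℕ) :
    PreservesGood ((tensoringLeft (ModuleCat.{u} R)).obj (ModuleCat.of R (Fin b → R))) := by
  induction b with
  | zero =>
    exact .of_subsingleton fun Y =>
      inferInstanceAs (Subsingleton (TensorProduct R (Fin 0 → R) Y))
  | succ b ih =>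
    obtain ⟨f, g, w, h⟩ := shortExact_pi R b
    have : Projective (ModuleCat.of R R) :=
      ModuleCat.projective_of_free (Module.Basis.singleton Unit R)
    exact .of_extension ((tensoringLeft _).map f) ((tensoringLeft _).map g) ih
      (.of_iso (leftUnitorNatIso (ModuleCat.{u} R)).symm .id)
      (tensor_map_injective_of_projective h) (tensor_map_surjective h) (tensor_map_exact h)

theorem preservesGood_tensor [IsNoetherianRing R] (L : ModuleCat.{u} R) [Module.Finite R L] :
    PreservesGood ((tensoringLeft (ModuleCat.{u} R)).obj L) := by
  obtain ⟨b, L', _, f, g, w, h⟩ := exists_shortExact_finite L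
  obtain ⟨b', L'', _, f', g', w', h'⟩ := exists_shortExact_finite L'
  refine .of_cokernel ((tensoringLeft _).map (g' ≫ f)) ((tensoringLeft _).map g)
    (preservesGood_tensor_pi b') (preservesGood_tensor_pi b) (tensor_map_surjective h)
    fun Y y => ?_
  refine (tensor_map_exact h Y y).trans ⟨?_, ?_⟩
  · rintro ⟨x, rfl⟩
    obtain ⟨z, rfl⟩ := tensor_map_surjective h' Y x
    exact ⟨z, ConcreteCategory.congr_hom (comp_whiskerRight g' f Y) z⟩
  · rintro ⟨z, rfl⟩
    exact ⟨(g' ▷ Y) z, (ConcreteCategory.congr_hom (comp_whiskerRight g' f Y) z).symm⟩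

instance flat_of_projective (P : ModuleCat.{u} R) [Projective P] : Module.Flat R P :=
  have := (IsProjective.iff_projective P).2 ‹_›
  inferInstance

/-- The complex `L ⊗ P` for a projective resolution `P`. -/
noncomputable abbrev tensorComplex (L : ModuleCat.{u} R) {Y : ModuleCat.{u} R}
    (P : ProjectiveResolution Y) : ChainComplex (ModuleCat.{u} R) ℕ :=
  (((tensoringLeft (ModuleCat.{u} R)).obj L).mapHomologicalComplex _).obj P.complex

/-- The map `L ⊗ P ⟶ L' ⊗ P` for a projective resolution `P`. -/
noncomputable abbrev tensorComplexMap {L L' : ModuleCat.{u} R} (f : L ⟶ L') {Y : ModuleCat.{u} R}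
    (P : ProjectiveResolution Y) : tensorComplex L P ⟶ tensorComplex L' P :=
  (NatTrans.mapHomologicalComplex ((tensoringLeft (ModuleCat.{u} R)).map f) _).app P.complex

/-- The short complex of complexes obtained by tensoring with a projective resolution. -/
noncomputable abbrev tensorShortComplex (S : ShortComplex (ModuleCat.{u} R)) {Y : ModuleCat.{u} R}
    (P : ProjectiveResolution Y) : ShortComplex (ChainComplex (ModuleCat.{u} R) ℕ) :=
  ShortComplex.mk (tensorComplexMap S.f P) (tensorComplexMap S.g P) (by
    ext n : 1
    change S.f ▷ _ ≫ S.g ▷ _ = 0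
    rw [← comp_whiskerRight, S.zero, MonoidalPreadditive.zero_whiskerRight])

theorem tensorShortComplex_shortExact {S : ShortComplex (ModuleCat.{u} R)} (hS : S.ShortExact)
    {Y : ModuleCat.{u} R} (P : ProjectiveResolution Y) :
    (tensorShortComplex S P).ShortExact :=
  HomologicalComplex.shortExact_of_degreewise_shortExact _ fun n =>
    ModuleCat.shortExact_mk (S.f ▷ P.complex.X n) (S.g ▷ P.complex.X n)
      (tensor_map_injective_of_flat hS _) (tensor_map_surjective hS _) (tensor_map_exact hS _)

theorem isZero_homology_tensorComplex (F : ModuleCat.{u} R) [Module.Flat R F]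
    {Y : ModuleCat.{u} R} (P : ProjectiveResolution Y) (n : ℕ) :
    IsZero ((tensorComplex F P).homology (n + 1)) := by
  rw [← HomologicalComplex.exactAt_iff_isZero_homology,
    HomologicalComplex.exactAt_iff' _ (n + 2) (n + 1) n
      (by simp only [ChainComplex.prev]; rfl) (by simp),
    ShortComplex.ShortExact.moduleCat_exact_iff_function_exact]
  have h := P.exact_succ n
  rw [ShortComplex.ShortExact.moduleCat_exact_iff_function_exact] at h
  exact Module.Flat.lTensor_exact F h

/-- Dimension shifting for `Tor`. -/
noncomputable def torSuccSuccIso {S : ShortComplex (ModuleCat.{u} R)} (hS : S.ShortExact)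
    [Module.Flat R S.X₂] (Y : ModuleCat.{u} R) (j : ℕ) :
    ((Tor (ModuleCat.{u} R) (j + 2)).obj S.X₃).obj Y ≅
      ((Tor (ModuleCat.{u} R) (j + 1)).obj S.X₁).obj Y :=
  let P := projectiveResolution Y
  P.isoLeftDerivedObj ((tensoringLeft (ModuleCat.{u} R)).obj S.X₃) (j + 2) ≪≫
    (tensorShortComplex_shortExact hS P).δIso (j + 2) (j + 1) (by simp)
      (isZero_homology_tensorComplex _ _ _) (isZero_homology_tensorComplex _ _ _) ≪≫
    (P.isoLeftDerivedObj ((tensoringLeft (ModuleCat.{u} R)).obj S.X₁) (j + 1)).symm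

theorem exists_mono_exact_of_iso {A B C A' B' C' : ModuleCat.{u} R} (e₁ : A ≅ A') (e₀ : B ≅ B')
    (e₂ : C ≅ C') {d : A' ⟶ B'} {t : B' ⟶ C'} {hdt : d ≫ t = 0} (hd : Mono d)
    (h : (ShortComplex.mk d t hdt).Exact) (φ : B ⟶ C) (hφ : φ = e₀.hom ≫ t ≫ e₂.inv) :
    ∃ (δ : A ⟶ B) (w : δ ≫ φ = 0), Mono δ ∧ (ShortComplex.mk _ _ w).Exact := by
  subst hφ
  exact ⟨e₁.hom ≫ d ≫ e₀.inv, by simp [reassoc_of% hdt], inferInstance,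
    ShortComplex.exact_of_iso (ShortComplex.isoMk e₁.symm e₀.symm e₂.symm (by simp) (by simp)) h⟩

theorem exists_torOne_exact {S : ShortComplex (ModuleCat.{u} R)} (hS : S.ShortExact)
    [Module.Flat R S.X₂] (Y : ModuleCat.{u} R) :
    ∃ (δ : ((Tor (ModuleCat.{u} R) 1).obj S.X₃).obj Y ⟶
        ((Tor (ModuleCat.{u} R) 0).obj S.X₁).obj Y)
      (w : δ ≫ ((Tor (ModuleCat.{u} R) 0).map S.f).app Y = 0),
      Mono δ ∧ (ShortComplex.mk _ _ w).Exact :=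
  let P := projectiveResolution Y
  have hT := tensorShortComplex_shortExact hS P
  exists_mono_exact_of_iso
    (P.isoLeftDerivedObj ((tensoringLeft (ModuleCat.{u} R)).obj S.X₃) 1)
    (P.isoLeftDerivedObj ((tensoringLeft (ModuleCat.{u} R)).obj S.X₁) 0)
    (P.isoLeftDerivedObj ((tensoringLeft (ModuleCat.{u} R)).obj S.X₂) 0)
    (hT.mono_δ 1 0 (by simp) (isZero_homology_tensorComplex _ _ _))
    (hT.homology_exact₁ 1 0 (by simp)) _ (ProjectiveResolution.leftDerived_app_eq _ P 0)

theorem preservesGood_kernel {Φ Ψ : ModuleCat.{u} R ⥤ ModuleCat.{u} R} (α : Φ ⟶ Ψ)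
    (hΦ : PreservesGood Φ) (hΨ : PreservesGood Ψ) : PreservesGood (kernel α) := by
  refine .of_kernel (kernel.ι α) α hΦ hΨ
    (fun Y => (ModuleCat.mono_iff_injective _).1 inferInstance) fun Y => ?_
  have h := (ShortComplex.exact_kernel α).map ((evaluation _ _).obj Y)
  rwa [ShortComplex.ShortExact.moduleCat_exact_iff_function_exact] at h

theorem exists_preservesGood_iso_tor [IsNoetherianRing R] (L : ModuleCat.{u} R)
    [Module.Finite R L] (j : ℕ) :
    ∃ Φ : ModuleCat.{u} R ⥤ ModuleCat.{u} R, PreservesGood Φ ∧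
      ∀ Y, Nonempty (((Tor (ModuleCat.{u} R) j).obj L).obj Y ≅ Φ.obj Y) := by
  have h₀ (L : ModuleCat.{u} R) [Module.Finite R L] :
      PreservesGood ((Tor (ModuleCat.{u} R) 0).obj L) :=
    have : PreservesFiniteColimits ((tensoringLeft (ModuleCat.{u} R)).obj L) :=
      inferInstanceAs (PreservesFiniteColimits (tensorLeft L))
    .of_iso (Functor.leftDerivedZeroIsoSelf ((tensoringLeft (ModuleCat.{u} R)).obj L)).symm
      (preservesGood_tensor L)
  match j with
  | 0 => exact ⟨_, h₀ L, fun Y => ⟨Iso.refl _⟩⟩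
  | 1 =>
    obtain ⟨b, L', _, f, g, w, h⟩ := exists_shortExact_finite L
    refine ⟨_, preservesGood_kernel ((Tor (ModuleCat.{u} R) 0).map f) (h₀ _) (h₀ _), fun Y => ?_⟩
    obtain ⟨δ, w', hδ, hex⟩ := exists_torOne_exact h Y
    have hex' := (ShortComplex.exact_kernel ((Tor (ModuleCat.{u} R) 0).map f)).map
      ((evaluation _ _).obj Y)
    have : Mono (ShortComplex.mk _ _ w').f := hδ
    have : Mono (((ShortComplex.mk _ _ (kernel.condition ((Tor (ModuleCat.{u} R) 0).map f))).map
      ((evaluation _ _).obj Y)).f) :=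
      inferInstanceAs (Mono ((kernel.ι ((Tor (ModuleCat.{u} R) 0).map f)).app Y))
    exact ⟨IsLimit.conePointUniqueUpToIso hex.fIsKernel hex'.fIsKernel⟩
  | j + 2 =>
    obtain ⟨b, L', _, f, g, w, h⟩ := exists_shortExact_finite L
    obtain ⟨Φ, hΦ, e⟩ := exists_preservesGood_iso_tor L' (j + 1)
    exact ⟨Φ, hΦ, fun Y => (e Y).map fun e => torSuccSuccIso h Y j ≪≫ e⟩

end TorFunctor

section ExtComparison

open Limits

variable {R : Type u} [CommRing R]

/-- The homology of a short complex of modules, as the target of a surjection from the cycles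
that vanishes exactly on boundaries. -/
noncomputable def homologyLinearEquivOfSurjective (S : ShortComplex (ModuleCat.{u} R)) {E : Type u}
    [AddCommGroup E] [Module R E] (φ : LinearMap.ker S.g.hom →ₗ[R] E)
    (hφ : Function.Surjective φ) (h : ∀ x, φ x = 0 ↔ ∃ y, S.f y = x.1) : S.homology ≃ₗ[R] E :=
  S.moduleCatHomologyIso.toLinearEquiv ≪≫ₗ
    Submodule.quotEquivOfEq _ (LinearMap.ker φ) (by
      ext x
      exact (exists_congr fun y => Subtype.ext_iff).trans (h x).symm) ≪≫ₗ
    φ.quotKerEquivOfSurjective hφ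

variable {A B : ModuleCat.{u} R} (P : ProjectiveResolution A)

theorem smul_extMk {n m : ℕ} (f : P.complex.X n ⟶ B) (hm : n + 1 = m)
    (hf : P.complex.d m n ≫ f = 0) (r : R) :
    r • P.extMk f m hm hf = P.extMk (r • f) m hm (by simp [hf]) := by
  rw [Abelian.Ext.smul_eq_comp_mk₀, P.extMk_comp_mk₀]
  simp

theorem extMk_zero_eq_zero_iff {m : ℕ} (f : P.complex.X 0 ⟶ B) (hm : 0 + 1 = m)
    (hf : P.complex.d m 0 ≫ f = 0) : P.extMk f m hm hf = 0 ↔ f = 0 := by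
  refine ⟨fun h => ?_, fun h => ?_⟩
  · rw [← P.extEquivCohomologyClass.apply_eq_iff_eq, P.extEquivCohomologyClass_extMk,
      P.extEquivCohomologyClass_zero, CochainComplex.HomComplex.CohomologyClass.mk_eq_zero_iff,
      CochainComplex.HomComplex.Cocycle.toSingleMk_mem_coboundaries_iff _ _ _ _ _ 1 (by lia)] at h
    obtain ⟨g, hg⟩ := h
    have hz : IsZero (P.cochainComplex.X 1) := P.cochainComplex.isZero_of_isStrictlyLE 0 1
    rw [← cancel_epi (P.cochainComplexXIso (-(0 : ℕ)) 0 rfl).hom, comp_zero]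
    rw [← hg, hz.eq_of_src g 0, comp_zero]
  · subst h
    exact P.extMk_zero m hm

/-- The class map from cocycles of the `Hom` complex to `Ext`. -/
noncomputable def extMkLinearMap (n : ℕ) :
    LinearMap.ker ((P.complex.linearYonedaObj R B).d n (n + 1)).hom →ₗ[R] Abelian.Ext A B n where
  toFun x := P.extMk (n := n) x.1 (n + 1) rfl x.2
  map_add' _ _ := (P.add_extMk _ _ _ _ _ _).symm
  map_smul' r _ := (smul_extMk P _ _ _ r).symm

theorem nonempty_ext_linearEquiv (A B : ModuleCat.{u} R) (n : ℕ) :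
    Nonempty (((Ext R (ModuleCat.{u} R) n).obj (Opposite.op A)).obj B ≃ₗ[R]
      Abelian.Ext A B n) := by
  let P := projectiveResolution A
  let K := P.complex.linearYonedaObj R B
  refine ⟨(P.isoExt (R := R) n B).toLinearEquiv ≪≫ₗ ?_⟩
  have hs : Function.Surjective (extMkLinearMap (B := B) P n) := fun ξ =>
    let ⟨f, hf, h⟩ := P.extMk_surjective ξ (n + 1) rfl
    ⟨⟨f, hf⟩, h⟩
  match n with
  | 0 =>
    exact (ShortComplex.homologyMapIso (K.isoSc' 0 0 1 (by simp) (by simp))).toLinearEquiv ≪≫ₗ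
      homologyLinearEquivOfSurjective (K.sc' 0 0 1) (extMkLinearMap P 0) hs fun x => by
        refine (extMk_zero_eq_zero_iff P x.1 rfl x.2).trans ?_
        have : (K.sc' 0 0 1).f = 0 := K.shape _ _ (by simp)
        rw [this]
        exact ⟨fun h => ⟨0, h.symm⟩, fun ⟨y, h⟩ => h.symm⟩
  | n + 1 =>
    exact (ShortComplex.homologyMapIso (K.isoSc' n (n + 1) (n + 2) (by simp)
      (by simp))).toLinearEquiv ≪≫ₗ
      homologyLinearEquivOfSurjective (K.sc' n (n + 1) (n + 2)) (extMkLinearMap P (n + 1)) hs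
        fun x => P.extMk_eq_zero_iff x.1 _ rfl x.2 n rfl

end ExtComparison

theorem ReesFam.IsGood.exists_polynomial {R : Type u} [CommRing R] {r : ℕ} {X : ReesFam R r}
    (hX : X.IsGood) (Q : ℕ → Type u) [∀ n, AddCommGroup (Q n)] [∀ n, Module R (Q n)]
    (e : ∀ n, Nonempty (Q n ≃ₗ[R] X.obj n)) :
    (∀ n, IsFiniteLength R (Q n)) ∧ ∃ (p : Polynomial ℚ) (N₀ : ℕ), ∀ n ≥ N₀, ∃ ℓ : ℕ,
      moduleLength R (Q n) = ℓ ∧ (ℓ : ℚ) = p.eval (n : ℚ) := by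
  refine ⟨fun n => (e n).elim fun e => e.symm.isFiniteLength (hX.isFiniteLength n), ?_⟩
  obtain ⟨p, N₀, h⟩ := hX.eventuallyPolynomial_length
  refine ⟨p, N₀, fun n hn => ⟨_, ?_, h n hn⟩⟩
  obtain ⟨e⟩ := e n
  rw [moduleLength, ← Module.coe_length, e.length_eq,
    ← ENat.natCast_toNat (Module.length_ne_top_iff.2 (hX.isFiniteLength n))]
  rfl
/-- Corollary 8. Let `(R, m)` be a commutative Noetherian local ring,
`L`, `M`, `N` finitely generated `R`-modules, and `I` an ideal with `I + ann_R M + ann_R N`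
`m`-primary.  Fix `i, j ≥ 0`.  Then both `Tor_j(L, Ext^i(N/IⁿN, M))` and
`Ext^j(L, Ext^i(N/IⁿN, M))` have finite length for all `n ≥ 1`, and there are polynomials
`p, q ∈ ℚ[X]` with `λ(Tor_j(L, Ext^i(N/IⁿN, M))) = p(n)` and
`λ(Ext^j(L, Ext^i(N/IⁿN, M))) = q(n)` for all `n ≫ 0`. -/
theorem stmt_17 {R : Type u} [CommRing R] [IsNoetherianRing R] [IsLocalRing R]
    (I : Ideal R)
    (L M N : Type u) [AddCommGroup L] [Module R L] [Module.Finite R L]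
    [AddCommGroup M] [Module R M] [Module.Finite R M]
    [AddCommGroup N] [Module R N] [Module.Finite R N]
    (hprimary : (I + Module.annihilator R M + Module.annihilator R N).radical =
      IsLocalRing.maximalIdeal R)
    (i j : ℕ) :
    (∀ n : ℕ, 1 ≤ n →
      IsFiniteLength R
        (torModule R j L (extModule R i (N ⧸ (I ^ n • ⊤ : Submodule R N)) M)) ∧
      IsFiniteLength R
        (extModule R j L (extModule R i (N ⧸ (I ^ n • ⊤ : Submodule R N)) M))) ∧
    (∃ (p : Polynomial ℚ) (N₀ : ℕ), ∀ n ≥ N₀, ∃ ℓ : ℕ,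
      moduleLength R
        (torModule R j L (extModule R i (N ⧸ (I ^ n • ⊤ : Submodule R N)) M)) = ℓ ∧
      (ℓ : ℚ) = p.eval (n : ℚ)) ∧
    (∃ (q : Polynomial ℚ) (N₀ : ℕ), ∀ n ≥ N₀, ∃ ℓ : ℕ,
      moduleLength R
        (extModule R j L (extModule R i (N ⧸ (I ^ n • ⊤ : Submodule R N)) M)) = ℓ ∧
      (ℓ : ℚ) = q.eval (n : ℚ)) := by

  obtain ⟨r, y, hy⟩ := Submodule.fg_iff_exists_fin_generating_family.1 (IsNoetherian.noetherian I)
  let y' (k : Fin r) : I := ⟨y k, hy ▸ Submodule.subset_span ⟨k, rfl⟩⟩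
  have hX : (extQuotPow N y' (ModuleCat.of R M) i).IsGood :=
    isGood_extQuotPow (M := ModuleCat.of R M) (y := y') hy hprimary i
  have e (n : ℕ) : Nonempty (ModuleCat.of R (extModule R i (N ⧸ (I ^ n • ⊤ : Submodule R N)) M) ≅
      (extQuotPow N y' (ModuleCat.of R M) i).obj n) :=
    (nonempty_ext_linearEquiv _ _ i).map LinearEquiv.toModuleIso
  obtain ⟨Φ, hΦ, eΦ⟩ := exists_preservesGood_iso_tor (ModuleCat.of R L) j
  have hT := (hΦ _ hX).exists_polynomial
    (fun n => torModule R j L (extModule R i (N ⧸ (I ^ n • ⊤ : Submodule R N)) M)) fun n =>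
      let ⟨e⟩ := e n
      let ⟨e'⟩ := eΦ (ModuleCat.of R (extModule R i (N ⧸ (I ^ n • ⊤ : Submodule R N)) M))
      ⟨(e' ≪≫ Φ.mapIso e).toLinearEquiv⟩
  have hE := (preservesGood_ext (ModuleCat.of R L) j _ hX).exists_polynomial
    (fun n => extModule R j L (extModule R i (N ⧸ (I ^ n • ⊤ : Submodule R N)) M)) fun n =>
      let ⟨e⟩ := e n
      let ⟨e'⟩ := nonempty_ext_linearEquiv (ModuleCat.of R L)
        (ModuleCat.of R (extModule R i (N ⧸ (I ^ n • ⊤ : Submodule R N)) M)) j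
      ⟨e' ≪≫ₗ ((extFunctorModule (ModuleCat.of R L) j).mapIso e).toLinearEquiv⟩
  exact ⟨fun n _ => ⟨hT.1 n, hE.1 n⟩, hT.2, hE.2⟩
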